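/- arXiv:math/0312136 — 2 statements merged into one kernel-verified Lean document; each statement's English description precedes it below -/
import Mathlib

section
/- Let F be a cellular automaton on a closed σ-invariant set X ⊆ A^ℤ and μ a σ-ergodic and F-invariant Borel probability measure with F(S(μ)) ⊆ S(μ). Then the average Lyapunov exponents are dominated by the (maximum) Lyapunov exponents: I_μ⁺ ≤ λ_μ⁺ and I_μ⁻ ≤ λ_μ⁻. -/
open MeasureTheory Filter Topology Set

noncomputable section

/-- The shift map `σ` on `ℤ → A`, defined by `(σ x) i = x (i + 1)`. -/
def shiftMap (A : Type*) : (ℤ → A) → (ℤ → A) := fun x i => x (i + 1)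

/-- The iterate `σ^j` of the shift, for `j : ℤ`: `(σ^j x) i = x (i + j)`. -/
def shiftIter {A : Type*} (j : ℤ) (x : ℤ → A) : ℤ → A := fun i => x (i + j)

/-- `F` admits a local rule of radius `r`:
`F(x)_i = f (x_{i-r}, …, x_{i+r})` for a block map `f : A^{2r+1} → A`. -/
def HasLocalRule {A : Type*} (F : (ℤ → A) → (ℤ → A)) (r : ℕ) : Prop :=
  ∃ f : (Fin (2 * r + 1) → A) → A, ∀ (x : ℤ → A) (i : ℤ),
    F x i = f fun j => x (i - (r : ℤ) + ((j : ℕ) : ℤ))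

/-- `W_s⁺(x) = {y ∈ X : y_i = x_i for all i ≥ s}`. -/
def Wplus {A : Type*} (X : Set (ℤ → A)) (s : ℤ) (x : ℤ → A) : Set (ℤ → A) :=
  {y ∈ X | ∀ i : ℤ, s ≤ i → y i = x i}

/-- `W_s⁻(x) = {y ∈ X : y_i = x_i for all i ≤ s}`. -/
def Wminus {A : Type*} (X : Set (ℤ → A)) (s : ℤ) (x : ℤ → A) : Set (ℤ → A) :=
  {y ∈ X | ∀ i : ℤ, i ≤ s → y i = x i}

/-- `Λ̃ₙ⁺(x) = min{s ≥ 0 : F^i(W₀⁺(x)) ⊆ W_s⁺(F^i(x)) for all 1 ≤ i ≤ n}`. -/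
def lamTildeP {A : Type*} (X : Set (ℤ → A)) (F : (ℤ → A) → (ℤ → A)) (n : ℕ)
    (x : ℤ → A) : ℕ :=
  sInf {s : ℕ | ∀ i : ℕ, 1 ≤ i → i ≤ n →
    F^[i] '' Wplus X 0 x ⊆ Wplus X (s : ℤ) (F^[i] x)}

/-- `Λ̃ₙ⁻(x) = min{s ≥ 0 : F^i(W₀⁻(x)) ⊆ W_{-s}⁻(F^i(x)) for all 1 ≤ i ≤ n}`. -/
def lamTildeM {A : Type*} (X : Set (ℤ → A)) (F : (ℤ → A) → (ℤ → A)) (n : ℕ)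
    (x : ℤ → A) : ℕ :=
  sInf {s : ℕ | ∀ i : ℕ, 1 ≤ i → i ≤ n →
    F^[i] '' Wminus X 0 x ⊆ Wminus X (-(s : ℤ)) (F^[i] x)}

/-- `Λₙ⁺(x) = max_{j ∈ ℤ} Λ̃ₙ⁺(σ^j x)`. -/
def lamP {A : Type*} (X : Set (ℤ → A)) (F : (ℤ → A) → (ℤ → A)) (n : ℕ)
    (x : ℤ → A) : ℕ :=
  sSup (Set.range fun j : ℤ => lamTildeP X F n (shiftIter j x))

/-- `Λₙ⁻(x) = max_{j ∈ ℤ} Λ̃ₙ⁻(σ^j x)`. -/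
def lamM {A : Type*} (X : Set (ℤ → A)) (F : (ℤ → A) → (ℤ → A)) (n : ℕ)
    (x : ℤ → A) : ℕ :=
  sSup (Set.range fun j : ℤ => lamTildeM X F n (shiftIter j x))

/-- `Iₙ⁺(x) = min{s ≥ 0 : F^i(W_{-s}⁺(x)) ⊆ W₀⁺(F^i(x)) for all 1 ≤ i ≤ n}`. -/
def Iplus {A : Type*} (X : Set (ℤ → A)) (F : (ℤ → A) → (ℤ → A)) (n : ℕ)
    (x : ℤ → A) : ℕ :=
  sInf {s : ℕ | ∀ i : ℕ, 1 ≤ i → i ≤ n →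
    F^[i] '' Wplus X (-(s : ℤ)) x ⊆ Wplus X 0 (F^[i] x)}

/-- `Iₙ⁻(x) = min{s ≥ 0 : F^i(W_s⁻(x)) ⊆ W₀⁻(F^i(x)) for all 1 ≤ i ≤ n}`. -/
def Iminus {A : Type*} (X : Set (ℤ → A)) (F : (ℤ → A) → (ℤ → A)) (n : ℕ)
    (x : ℤ → A) : ℕ :=
  sInf {s : ℕ | ∀ i : ℕ, 1 ≤ i → i ≤ n →
    F^[i] '' Wminus X (s : ℤ) x ⊆ Wminus X 0 (F^[i] x)}

/-- Average Lyapunov exponent `I_μ⁺ = liminf_n (∫ Iₙ⁺ dμ) / n`. -/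
def avgIplus {A : Type*} [MeasurableSpace A] (X : Set (ℤ → A))
    (F : (ℤ → A) → (ℤ → A)) (μ : Measure (ℤ → A)) : ℝ :=
  Filter.liminf (fun n : ℕ => (∫ x, (Iplus X F n x : ℝ) ∂μ) / n) Filter.atTop

/-- Average Lyapunov exponent `I_μ⁻ = liminf_n (∫ Iₙ⁻ dμ) / n`. -/
def avgIminus {A : Type*} [MeasurableSpace A] (X : Set (ℤ → A))
    (F : (ℤ → A) → (ℤ → A)) (μ : Measure (ℤ → A)) : ℝ :=
  Filter.liminf (fun n : ℕ => (∫ x, (Iminus X F n x : ℝ) ∂μ) / n) Filter.atTop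

/-- The topological support `S(μ)` of a measure `μ` on `ℤ → A`. -/
def msupp {A : Type*} [TopologicalSpace A] [MeasurableSpace A]
    (μ : Measure (ℤ → A)) : Set (ℤ → A) :=
  {x | ∀ U : Set (ℤ → A), IsOpen U → x ∈ U → 0 < μ U}

/-- `x` is an equicontinuous point of `F` on `X`: for every `ε = 2^{-m}` there is a
`δ = 2^{-k}` such that points of `X` agreeing with `x` on coordinates `|j| ≤ k`
have all their `F`-iterates agreeing with those of `x` on coordinates `|j| ≤ m`. -/
def IsEquicontPt {A : Type*} (X : Set (ℤ → A)) (F : (ℤ → A) → (ℤ → A))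
    (x : ℤ → A) : Prop :=
  ∀ m : ℕ, ∃ k : ℕ, ∀ y ∈ X, (∀ j : ℤ, |j| ≤ (k : ℤ) → y j = x j) →
    ∀ n : ℕ, ∀ j : ℤ, |j| ≤ (m : ℤ) → F^[n] y j = F^[n] x j

/-- Entropy `H_μ(α) = ∑ -μ(A) log μ(A)` of the finite partition given by the
fibers of `α`. -/
def partEnt {Ω : Type*} [MeasurableSpace Ω] (μ : Measure Ω) {I : Type*} [Fintype I]
    (α : Ω → I) : ℝ :=
  ∑ i : I, Real.negMulLog (μ (α ⁻¹' {i})).toReal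

/-- Metric entropy `h_μ(T, α)` of `T` relative to the finite partition `α`
(the limit of the subadditive sequence `H_μ(α ∨ T⁻¹α ∨ … ∨ T^{-n}α)/(n+1)`
equals its infimum). -/
def entropyPart {Ω : Type*} [MeasurableSpace Ω] (μ : Measure Ω) (T : Ω → Ω)
    {k : ℕ} (α : Ω → Fin k) : ℝ :=
  ⨅ n : ℕ, partEnt μ (fun x (i : Fin (n + 1)) => α (T^[(i : ℕ)] x)) / (n + 1)

/-- Kolmogorov–Sinai metric entropy `h_μ(T)`: supremum of `h_μ(T, α)` over all
finite measurable partitions `α`. -/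
def metricEntropy {Ω : Type*} [MeasurableSpace Ω] (μ : Measure Ω) (T : Ω → Ω) : ℝ :=
  ⨆ p : {q : Σ k : ℕ, Ω → Fin k // Measurable q.2}, entropyPart μ T p.1.2

/-- `B ∈ A^{2k+1}` is a blocking word for `F` (with radius `r`): there are `i` with
`2i+1 ≥ r` and words `vₙ ∈ A^{2i+1}`, independent of `x`, such that every `x ∈ X`
with `x(-k,k) = B` satisfies `F^n(x)(-i,i) = vₙ` for all `n ≥ 1`. -/
def IsBlockingWord {A : Type*} (X : Set (ℤ → A)) (F : (ℤ → A) → (ℤ → A)) (r k : ℕ)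
    (B : Fin (2 * k + 1) → A) : Prop :=
  ∃ i : ℕ, r ≤ 2 * i + 1 ∧ ∃ v : ℕ → Fin (2 * i + 1) → A,
    ∀ x ∈ X, (∀ j : Fin (2 * k + 1), x (((j : ℕ) : ℤ) - (k : ℤ)) = B j) →
      ∀ n : ℕ, 1 ≤ n → ∀ j : Fin (2 * i + 1),
        F^[n] x (((j : ℕ) : ℤ) - (i : ℤ)) = v n j

/-- `D(n, 2^{-p})`: minimal cardinality of an `(n, 2^{-p})`-covering (spanning) set
for `F`, where closeness in the Bowen metric `d_n` up to `2^{-p}` means agreement of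
all iterates `F^i`, `i ≤ n`, on the coordinates `|j| ≤ p`. -/
def coverNum {A : Type*} (F : (ℤ → A) → (ℤ → A)) (n p : ℕ) : ℕ :=
  sInf {N : ℕ | ∃ S : Finset (ℤ → A), S.card ≤ N ∧ ∀ x : ℤ → A, ∃ y ∈ S,
    ∀ i : ℕ, i ≤ n → ∀ j : ℤ, |j| ≤ (p : ℤ) → F^[i] x j = F^[i] y j}

/-- Topological entropy `h_top(F) = lim_{ε→0} lim_n (1/n) log D(n, ε)`. -/
def htop {A : Type*} (F : (ℤ → A) → (ℤ → A)) : ℝ :=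
  ⨆ p : ℕ, Filter.limsup (fun n : ℕ => Real.log (coverNum F n p) / n) Filter.atTop

end

/-- The `i`-th iterate of a cellular automaton of radius `r` at coordinate `j` depends only on the
window `[j - r * i, j + r * i]`. -/
lemma HasLocalRule.iterate_apply_eq {A : Type*} {F : (ℤ → A) → (ℤ → A)} {r : ℕ}
    (hF : HasLocalRule F r) {x y : ℤ → A} (i : ℕ) (j : ℤ)
    (h : ∀ k : ℤ, j - (r * i : ℕ) ≤ k → k ≤ j + (r * i : ℕ) → y k = x k) :
    F^[i] y j = F^[i] x j := by
  obtain ⟨f, hf⟩ := hF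
  induction i generalizing j with
  | zero => exact h j (by simp) (by simp)
  | succ i ih =>
    rw [Function.iterate_succ_apply', Function.iterate_succ_apply', hf, hf]
    congr 1
    funext k
    have hk := k.isLt
    refine ih _ fun l hl₁ hl₂ => h l ?_ ?_ <;> push_cast [mul_add] at * <;> omega

lemma HasLocalRule.iterate_shiftIter {A : Type*} {F : (ℤ → A) → (ℤ → A)} {r : ℕ}
    (hF : HasLocalRule F r) (i : ℕ) (j : ℤ) (x : ℤ → A) :
    F^[i] (shiftIter j x) = shiftIter j (F^[i] x) := by
  obtain ⟨f, hf⟩ := hF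
  have hcomm : Function.Commute F (shiftIter j) := by
    intro y
    funext k
    simp only [shiftIter, hf]
    congr 1
    funext l
    congr 1
    ring
  exact (hcomm.iterate_left i) x

lemma shiftIter_mem {A : Type*} {X : Set (ℤ → A)} (hX : shiftMap A '' X = X) (j : ℤ)
    {x : ℤ → A} (hx : x ∈ X) : shiftIter j x ∈ X := by
  induction j with
  | zero =>
    convert hx using 1
    funext k
    simp [shiftIter]
  | succ n ih =>
    rw [← hX]
    refine ⟨_, ih, ?_⟩
    funext k
    simp only [shiftMap, shiftIter]
    congr 1
    ring
  | pred n ih =>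
    rw [← hX] at ih
    obtain ⟨y, hy, hyx⟩ := ih
    convert hy using 1
    funext k
    have := congrFun hyx (k - 1)
    simp only [shiftMap, shiftIter, sub_add_cancel] at this
    rw [this, shiftIter]
    congr 1
    ring

lemma mul_mem_lamTildeP_set {A : Type*} {X : Set (ℤ → A)} {F : (ℤ → A) → (ℤ → A)}
    (hFX : Set.MapsTo F X X) {r : ℕ} (hF : HasLocalRule F r) (n : ℕ) (x : ℤ → A) :
    r * n ∈ {s : ℕ | ∀ i : ℕ, 1 ≤ i → i ≤ n →
      F^[i] '' Wplus X 0 x ⊆ Wplus X (s : ℤ) (F^[i] x)} := by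
  rintro i - hin _ ⟨y, ⟨hyX, hy⟩, rfl⟩
  refine ⟨hFX.iterate i hyX, fun j hj => hF.iterate_apply_eq i j fun k hk₁ hk₂ => hy k ?_⟩
  have : r * i ≤ r * n := Nat.mul_le_mul_left r hin
  omega

lemma lamTildeP_le {A : Type*} {X : Set (ℤ → A)} {F : (ℤ → A) → (ℤ → A)}
    (hFX : Set.MapsTo F X X) {r : ℕ} (hF : HasLocalRule F r) (n : ℕ) (x : ℤ → A) :
    lamTildeP X F n x ≤ r * n :=
  Nat.sInf_le (mul_mem_lamTildeP_set hFX hF n x)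

lemma lamP_le {A : Type*} {X : Set (ℤ → A)} {F : (ℤ → A) → (ℤ → A)}
    (hFX : Set.MapsTo F X X) {r : ℕ} (hF : HasLocalRule F r) (n : ℕ) (x : ℤ → A) :
    lamP X F n x ≤ r * n := by
  refine csSup_le (Set.range_nonempty _) ?_
  rintro _ ⟨j, rfl⟩
  exact lamTildeP_le hFX hF n _

lemma Iplus_le_lamP {A : Type*} {X : Set (ℤ → A)} (hX : shiftMap A '' X = X)
    {F : (ℤ → A) → (ℤ → A)} (hFX : Set.MapsTo F X X) {r : ℕ} (hF : HasLocalRule F r)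
    (n : ℕ) (x : ℤ → A) : Iplus X F n x ≤ lamP X F n x := by
  set s := lamP X F n x with hs
  refine Nat.sInf_le ?_
  rintro i hi hin _ ⟨y, ⟨hyX, hy⟩, rfl⟩
  refine ⟨hFX.iterate i hyX, fun k hk => ?_⟩
  have hle : lamTildeP X F n (shiftIter (-(s : ℤ)) x) ≤ s := by
    refine le_csSup ⟨r * n, ?_⟩ ⟨-(s : ℤ), rfl⟩
    rintro _ ⟨j, rfl⟩
    exact lamTildeP_le hFX hF n _
  have hmem := Nat.sInf_mem ⟨_, mul_mem_lamTildeP_set hFX hF n (shiftIter (-(s : ℤ)) x)⟩ i hi hin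
  change _ ⊆ Wplus X ((lamTildeP X F n (shiftIter (-(s : ℤ)) x) : ℕ) : ℤ) _ at hmem
  have hz : shiftIter (-(s : ℤ)) y ∈ Wplus X 0 (shiftIter (-(s : ℤ)) x) :=
    ⟨shiftIter_mem hX _ hyX, fun j hj => hy _ (by omega)⟩
  have h := (hmem ⟨_, hz, rfl⟩).2 (k + s) (by omega)
  rw [hF.iterate_shiftIter, hF.iterate_shiftIter] at h
  simpa [shiftIter] using h

lemma mul_mem_lamTildeM_set {A : Type*} {X : Set (ℤ → A)} {F : (ℤ → A) → (ℤ → A)}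
    (hFX : Set.MapsTo F X X) {r : ℕ} (hF : HasLocalRule F r) (n : ℕ) (x : ℤ → A) :
    r * n ∈ {s : ℕ | ∀ i : ℕ, 1 ≤ i → i ≤ n →
      F^[i] '' Wminus X 0 x ⊆ Wminus X (-(s : ℤ)) (F^[i] x)} := by
  rintro i - hin _ ⟨y, ⟨hyX, hy⟩, rfl⟩
  refine ⟨hFX.iterate i hyX, fun j hj => hF.iterate_apply_eq i j fun k hk₁ hk₂ => hy k ?_⟩
  have : r * i ≤ r * n := Nat.mul_le_mul_left r hin
  omega

lemma lamTildeM_le {A : Type*} {X : Set (ℤ → A)} {F : (ℤ → A) → (ℤ → A)}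
    (hFX : Set.MapsTo F X X) {r : ℕ} (hF : HasLocalRule F r) (n : ℕ) (x : ℤ → A) :
    lamTildeM X F n x ≤ r * n :=
  Nat.sInf_le (mul_mem_lamTildeM_set hFX hF n x)

lemma lamM_le {A : Type*} {X : Set (ℤ → A)} {F : (ℤ → A) → (ℤ → A)}
    (hFX : Set.MapsTo F X X) {r : ℕ} (hF : HasLocalRule F r) (n : ℕ) (x : ℤ → A) :
    lamM X F n x ≤ r * n := by
  refine csSup_le (Set.range_nonempty _) ?_
  rintro _ ⟨j, rfl⟩
  exact lamTildeM_le hFX hF n _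

lemma Iminus_le_lamM {A : Type*} {X : Set (ℤ → A)} (hX : shiftMap A '' X = X)
    {F : (ℤ → A) → (ℤ → A)} (hFX : Set.MapsTo F X X) {r : ℕ} (hF : HasLocalRule F r)
    (n : ℕ) (x : ℤ → A) : Iminus X F n x ≤ lamM X F n x := by
  set s := lamM X F n x with hs
  refine Nat.sInf_le ?_
  rintro i hi hin _ ⟨y, ⟨hyX, hy⟩, rfl⟩
  refine ⟨hFX.iterate i hyX, fun k hk => ?_⟩
  have hle : lamTildeM X F n (shiftIter ((s : ℤ)) x) ≤ s := by
    refine le_csSup ⟨r * n, ?_⟩ ⟨(s : ℤ), rfl⟩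
    rintro _ ⟨j, rfl⟩
    exact lamTildeM_le hFX hF n _
  have hmem := Nat.sInf_mem ⟨_, mul_mem_lamTildeM_set hFX hF n (shiftIter ((s : ℤ)) x)⟩ i hi hin
  change _ ⊆ Wminus X (-((lamTildeM X F n (shiftIter ((s : ℤ)) x) : ℕ) : ℤ)) _ at hmem
  have hz : shiftIter ((s : ℤ)) y ∈ Wminus X 0 (shiftIter ((s : ℤ)) x) :=
    ⟨shiftIter_mem hX _ hyX, fun j hj => hy _ (by omega)⟩
  have h := (hmem ⟨_, hz, rfl⟩).2 (k - s) (by omega)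
  rw [hF.iterate_shiftIter, hF.iterate_shiftIter] at h
  simpa [shiftIter] using h

/-- A reverse Fatou type bound which does not require `u` or `v` to be measurable. -/
lemma liminf_integral_div_le {Ω : Type*} [MeasurableSpace Ω] {μ : Measure Ω}
    [IsProbabilityMeasure μ] {u v : ℕ → Ω → ℕ} {r : ℕ} {l : ℝ} (huv : ∀ n x, u n x ≤ v n x)
    (hv : ∀ n x, v n x ≤ r * n)
    (hl : ∀ᵐ x ∂μ, Tendsto (fun n : ℕ => (v n x : ℝ) / n) atTop (𝓝 l)) :
    liminf (fun n : ℕ => (∫ x, (u n x : ℝ) ∂μ) / n) atTop ≤ l := by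
  classical
  have hvr (n : ℕ) (x : Ω) : (v n x : ℝ) / n ≤ r :=
    div_le_of_le_mul₀ n.cast_nonneg r.cast_nonneg (mod_cast hv n x)
  have hv0 (n : ℕ) (x : Ω) : 0 ≤ (v n x : ℝ) / n := by positivity
  have hl0 : 0 ≤ l := by
    obtain ⟨x, hx⟩ := hl.exists
    exact ge_of_tendsto' hx fun n => hv0 n x
  have huv' (n : ℕ) (x : Ω) : (u n x : ℝ) / n ≤ (v n x : ℝ) / n := by
    gcongr
    exact huv n x
  let g : ℕ → Ω → ℝ := fun n =>
    if AEStronglyMeasurable (fun x => (u n x : ℝ)) μ then fun x => max ((u n x : ℝ) / n) l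
    else fun _ => l
  have hgm (n : ℕ) : AEStronglyMeasurable (g n) μ := by
    by_cases h : AEStronglyMeasurable (fun x => (u n x : ℝ)) μ
    · simp only [g, if_pos h, div_eq_mul_inv]
      exact (h.mul_const _).sup aestronglyMeasurable_const
    · simp only [g, if_neg h]
      exact aestronglyMeasurable_const
  have hlg (n : ℕ) (x : Ω) : l ≤ g n x := by
    simp only [g]
    split_ifs <;> simp
  have hgv (n : ℕ) (x : Ω) : g n x ≤ max ((v n x : ℝ) / n) l := by
    simp only [g]
    split_ifs
    · exact max_le_max_right l (huv' n x)
    · exact le_max_right _ _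
  have hgb (n : ℕ) (x : Ω) : ‖g n x‖ ≤ max (r : ℝ) l := by
    rw [Real.norm_of_nonneg (hl0.trans (hlg n x))]
    exact (hgv n x).trans (max_le_max_right l (hvr n x))
  have hlim : Tendsto (fun n => ∫ x, g n x ∂μ) atTop (𝓝 l) := by
    have := tendsto_integral_of_dominated_convergence (μ := μ) (F := g) (f := fun _ => l)
      (fun _ => max (r : ℝ) l) hgm (integrable_const _) (fun n => .of_forall (hgb n)) (by
        filter_upwards [hl] with x hx
        refine tendsto_of_tendsto_of_tendsto_of_le_of_le tendsto_const_nhds ?_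
          (fun n => hlg n x) (fun n => hgv n x)
        simpa using hx.max (tendsto_const_nhds (x := l)))
    simpa using this
  have hle (n : ℕ) : (∫ x, (u n x : ℝ) ∂μ) / n ≤ ∫ x, g n x ∂μ := by
    by_cases h : AEStronglyMeasurable (fun x => (u n x : ℝ)) μ
    · rw [← integral_div]
      refine integral_mono_of_nonneg (.of_forall fun x => by positivity)
        (Integrable.of_bound (hgm n) _ (.of_forall (hgb n))) (.of_forall fun x => ?_)
      simp only [g, if_pos h]
      exact le_max_left _ _
    · rw [integral_non_aestronglyMeasurable h, zero_div]
      exact integral_nonneg fun x => hl0.trans (hlg n x)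
  rw [← hlim.liminf_eq]
  refine liminf_le_liminf (.of_forall hle) ?_ hlim.isBoundedUnder_le.isCoboundedUnder_ge
  exact isBoundedUnder_of ⟨0, fun n => div_nonneg (integral_nonneg fun x => by positivity)
    n.cast_nonneg⟩

/-- The average Lyapunov exponents are dominated by the maximum Lyapunov
exponents: `I_μ⁺ ≤ λ_μ⁺` and `I_μ⁻ ≤ λ_μ⁻`. -/
theorem stmt4 {A : Type*} [Fintype A] [TopologicalSpace A] [DiscreteTopology A]
    [MeasurableSpace A] [BorelSpace A]
    (X : Set (ℤ → A)) (hXcl : IsClosed X) (hXσ : shiftMap A '' X = X)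
    (F : (ℤ → A) → (ℤ → A)) (hFX : Set.MapsTo F X X) (hFc : Continuous F)
    (hFσ : ∀ x, F (shiftMap A x) = shiftMap A (F x))
    (r : ℕ) (hr : 1 ≤ r) (hloc : HasLocalRule F r)
    (μ : Measure (ℤ → A)) [IsProbabilityMeasure μ]
    (herg : Ergodic (shiftMap A) μ) (hFinv : MeasurePreserving F μ μ)
    (hsuppX : msupp μ ⊆ X) (hFsupp : F '' msupp μ ⊆ msupp μ)
    (lp lm : ℝ)
    (hlp : ∀ᵐ x ∂μ, Filter.Tendsto (fun n : ℕ => (lamP X F n x : ℝ) / n)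
      Filter.atTop (nhds lp))
    (hlm : ∀ᵐ x ∂μ, Filter.Tendsto (fun n : ℕ => (lamM X F n x : ℝ) / n)
      Filter.atTop (nhds lm)) :
    avgIplus X F μ ≤ lp ∧ avgIminus X F μ ≤ lm := by
  exact ⟨liminf_integral_div_le (Iplus_le_lamP hXσ hFX hloc) (lamP_le hFX hloc) hlp,
    liminf_integral_div_le (Iminus_le_lamM hXσ hFX hloc) (lamM_le hFX hloc) hlm⟩
end

section
/- Let F be a cellular automaton on a closed σ-invariant set X ⊆ A^ℤ and μ a σ-ergodic and F-invariant Borel probability measure such that F has no equicontinuous point in the topological support S(μ). Then h_μ(F) ≤ h_μ(σ) · (I_μ⁺ + I_μ⁻). -/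
open MeasureTheory Filter Topology Set

section FiniteEntropy

set_option linter.unusedSectionVars false

open Real

lemma negMulLog_add_le {x y : ℝ} (hx : 0 ≤ x) (hy : 0 ≤ y) :
    negMulLog (x + y) ≤ negMulLog x + negMulLog y := by
  rcases hx.eq_or_lt with rfl | hx
  · simp
  rcases hy.eq_or_lt with rfl | hy
  · simp
  have h1 : log x ≤ log (x + y) := log_le_log hx (by linarith)
  have h2 : log y ≤ log (x + y) := log_le_log hy (by linarith)
  simp only [negMulLog]
  nlinarith

lemma negMulLog_sum_le {ι : Type*} (s : Finset ι) (p : ι → ℝ) (hp : ∀ i, 0 ≤ p i) :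
    negMulLog (∑ i ∈ s, p i) ≤ ∑ i ∈ s, negMulLog (p i) := by
  classical
  induction s using Finset.induction_on with
  | empty => simp
  | insert a s ha ih =>
    rw [Finset.sum_insert ha, Finset.sum_insert ha]
    exact (negMulLog_add_le (hp a) (Finset.sum_nonneg fun i _ => hp i)).trans
      (by linarith)

/-- Subadditivity of entropy for an unnormalised joint distribution `p`. -/
lemma sum_negMulLog_add_le {I J : Type*} [Fintype I] [Fintype J] (p : I → J → ℝ)
    (hp : ∀ i j, 0 ≤ p i j) :
    ∑ i, ∑ j, negMulLog (p i j) + negMulLog (∑ i, ∑ j, p i j)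
      ≤ ∑ i, negMulLog (∑ j, p i j) + ∑ j, negMulLog (∑ i, p i j) := by
  set P := ∑ i, ∑ j, p i j with hP
  set a : I → ℝ := fun i => ∑ j, p i j with ha
  set b : J → ℝ := fun j => ∑ i, p i j with hb
  have hPa : P = ∑ i, a i := rfl
  have hPb : P = ∑ j, b j := Finset.sum_comm
  have hP0 : 0 ≤ P := Finset.sum_nonneg fun i _ => Finset.sum_nonneg fun j _ => hp i j
  have key : ∀ i j, p i j * (log (a i) + log (b j) - log P - log (p i j))
      ≤ a i * b j / P - p i j := by
    intro i j
    have ha0 : p i j ≤ a i := Finset.single_le_sum (fun j _ => hp i j) (Finset.mem_univ j)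
    have hb0 : p i j ≤ b j :=
      Finset.single_le_sum (f := fun i => p i j) (fun i _ => hp i j) (Finset.mem_univ i)
    have hPai : a i ≤ P := Finset.single_le_sum (f := a)
      (fun i _ => Finset.sum_nonneg fun j _ => hp i j) (Finset.mem_univ i)
    rcases (hp i j).eq_or_lt with h | h
    · rw [← h] at ha0 hb0 ⊢
      simp only [zero_mul, sub_zero]
      positivity
    · have h1 : 0 < a i := h.trans_le ha0
      have h2 : 0 < b j := h.trans_le hb0
      have h3 : 0 < P := h1.trans_le hPai
      have : log (a i) + log (b j) - log P - log (p i j) = log (a i * b j / P / p i j) := by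
        rw [log_div (by positivity) h.ne', log_div (by positivity) h3.ne',
          log_mul h1.ne' h2.ne']
      rw [this]
      have h4 := log_le_sub_one_of_pos (x := a i * b j / P / p i j) (by positivity)
      calc p i j * log (a i * b j / P / p i j) ≤ p i j * (a i * b j / P / p i j - 1) := by
            gcongr
        _ = _ := by field_simp
  have hsum := Finset.sum_le_sum fun i (_ : i ∈ Finset.univ) =>
    Finset.sum_le_sum fun j (_ : j ∈ Finset.univ) => key i j
  have hR : ∑ i, ∑ j, (a i * b j / P - p i j) = 0 := by
    have h1 : ∑ i, ∑ j, a i * b j / P = P * P / P := by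
      simp_rw [← Finset.sum_div, ← Finset.mul_sum, ← hPb, ← Finset.sum_mul, ← hPa]
    simp_rw [Finset.sum_sub_distrib]
    rw [h1, ← hP]
    rcases hP0.eq_or_lt with h | h
    · rw [← h]; simp
    · field_simp; simp
  have hL : ∑ i, ∑ j, p i j * (log (a i) + log (b j) - log P - log (p i j))
      = ∑ i, ∑ j, negMulLog (p i j) + negMulLog P - ∑ i, negMulLog (a i)
        - ∑ j, negMulLog (b j) := by
    have e1 : ∑ i, ∑ j, p i j * log (a i) = ∑ i, a i * log (a i) := by
      simp_rw [← Finset.sum_mul]; rfl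
    have e2 : ∑ i, ∑ j, p i j * log (b j) = ∑ j, b j * log (b j) := by
      rw [Finset.sum_comm]; simp_rw [← Finset.sum_mul]; rfl
    have e3 : ∑ i, ∑ j, p i j * log P = P * log P := by
      simp_rw [← Finset.sum_mul]; rfl
    simp only [negMulLog, neg_mul, Finset.sum_neg_distrib]
    simp_rw [mul_sub, mul_add, Finset.sum_sub_distrib, Finset.sum_add_distrib, e1, e2, e3]
    ring
  linarith

variable {Ω : Type*} [MeasurableSpace Ω] (μ : Measure Ω) [IsProbabilityMeasure μ]
  {I J K : Type*} [Fintype I] [MeasurableSpace I] [MeasurableSingletonClass I]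
  [Fintype J] [MeasurableSpace J] [MeasurableSingletonClass J]
  [Fintype K] [MeasurableSpace K] [MeasurableSingletonClass K]

/-- Conditional entropy `H_μ(f | g)` of finite-valued functions. -/
noncomputable def condH (f : Ω → I) (g : Ω → J) : ℝ :=
  partEnt μ (fun x => (f x, g x)) - partEnt μ g

lemma partEnt_eq (f : Ω → I) : partEnt μ f = ∑ i, negMulLog (μ.real (f ⁻¹' {i})) := rfl

lemma real_preimage_eq_sum {g : Ω → J} (hg : Measurable g) {s : Set Ω}
    (hs : MeasurableSet s) : μ.real s = ∑ j, μ.real (s ∩ g ⁻¹' {j}) := by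
  classical
  rw [← measureReal_biUnion_finset]
  · congr 1; ext x; simp
  · intro i _ j _ hij
    refine Set.disjoint_left.2 fun x hx hx' => hij ?_
    exact hx.2.symm.trans hx'.2
  · intro j _; exact hs.inter (hg (measurableSet_singleton j))

lemma prod_preimage (f : Ω → I) (g : Ω → J) (i : I) (j : J) :
    (fun x => (f x, g x)) ⁻¹' {(i, j)} = f ⁻¹' {i} ∩ g ⁻¹' {j} := by
  ext x; simp [Prod.ext_iff]

lemma partEnt_nonneg (f : Ω → I) : 0 ≤ partEnt μ f :=
  Finset.sum_nonneg fun _ _ => negMulLog_nonneg measureReal_nonneg measureReal_le_one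

lemma partEnt_comp_le {g : Ω → J} (hg : Measurable g) (φ : J → I) :
    partEnt μ (fun x => φ (g x)) ≤ partEnt μ g := by
  classical
  rw [partEnt_eq, partEnt_eq, ← Finset.sum_fiberwise (s := Finset.univ) (g := φ)]
  refine Finset.sum_le_sum fun i _ => ?_
  have : μ.real ((fun x => φ (g x)) ⁻¹' {i})
      = ∑ j with φ j = i, μ.real (g ⁻¹' {j}) := by
    rw [← measureReal_biUnion_finset]
    · congr 1; ext x; simp
    · intro i _ j _ hij
      refine Set.disjoint_left.2 fun x hx hx' => hij ?_
      exact hx.symm.trans hx'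
    · intro j _; exact hg (measurableSet_singleton j)
  rw [this]
  exact negMulLog_sum_le _ _ fun _ => measureReal_nonneg

lemma partEnt_le_of_factor {f : Ω → I} {g : Ω → J} (hg : Measurable g)
    (h : ∀ x y, g x = g y → f x = f y) : partEnt μ f ≤ partEnt μ g := by
  classical
  obtain ⟨x₀⟩ : Nonempty Ω := nonempty_of_isProbabilityMeasure μ
  let φ : J → I := fun j => if hj : ∃ x, g x = j then f hj.choose else f x₀
  have hφ : (fun x => φ (g x)) = f := by
    ext x
    have hj : ∃ y, g y = g x := ⟨x, rfl⟩
    simp only [φ, hj, dif_pos]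
    exact h _ _ hj.choose_spec
  have := partEnt_comp_le μ hg φ
  rwa [hφ] at this

lemma partEnt_eq_of_factor {f : Ω → I} {g : Ω → J} (hf : Measurable f) (hg : Measurable g)
    (h : ∀ x y, g x = g y ↔ f x = f y) : partEnt μ f = partEnt μ g :=
  le_antisymm (partEnt_le_of_factor μ (f := f) (g := g) hg fun x y => (h x y).1)
    (partEnt_le_of_factor μ (f := g) (g := f) hf fun x y => (h x y).2)

/-- Strong subadditivity of entropy. -/
lemma partEnt_submodular {f : Ω → I} {g : Ω → J} {h : Ω → K} (hf : Measurable f)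
    (hg : Measurable g) (hh : Measurable h) :
    partEnt μ (fun x => (f x, g x, h x)) + partEnt μ h
      ≤ partEnt μ (fun x => (f x, h x)) + partEnt μ (fun x => (g x, h x)) := by
  simp only [partEnt_eq, Fintype.sum_prod_type_right, prod_preimage]
  set p : K → I → J → ℝ := fun k i j => μ.real (f ⁻¹' {i} ∩ (g ⁻¹' {j} ∩ h ⁻¹' {k})) with hp
  have mf := fun i => hf (measurableSet_singleton i)
  have mg := fun i => hg (measurableSet_singleton i)
  have mh := fun i => hh (measurableSet_singleton i)
  have e1 : ∀ i k, μ.real (f ⁻¹' {i} ∩ h ⁻¹' {k}) = ∑ j, p k i j := by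
    intro i k
    rw [real_preimage_eq_sum μ hg ((mf i).inter (mh k))]
    refine Finset.sum_congr rfl fun j _ => ?_
    rw [hp]; congr 1; ext x; simp; tauto
  have e2 : ∀ j k, μ.real (g ⁻¹' {j} ∩ h ⁻¹' {k}) = ∑ i, p k i j := by
    intro j k
    rw [real_preimage_eq_sum μ hf ((mg j).inter (mh k))]
    refine Finset.sum_congr rfl fun i _ => ?_
    rw [hp]; congr 1; ext x; simp; tauto
  have e3 : ∀ k, μ.real (h ⁻¹' {k}) = ∑ i, ∑ j, p k i j := by
    intro k
    rw [real_preimage_eq_sum μ hf (mh k)]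
    refine Finset.sum_congr rfl fun i _ => ?_
    rw [← e1]; congr 1; ext x; simp; tauto
  simp_rw [e1, e2, e3]
  have e4 : ∀ k, ∑ j, ∑ i, negMulLog (μ.real (f ⁻¹' {i} ∩ (g ⁻¹' {j} ∩ h ⁻¹' {k})))
      = ∑ i, ∑ j, negMulLog (p k i j) := fun k => Finset.sum_comm
  simp_rw [e4]
  rw [← Finset.sum_add_distrib, ← Finset.sum_add_distrib]
  exact Finset.sum_le_sum fun k _ => sum_negMulLog_add_le (p k) fun _ _ => measureReal_nonneg

lemma condH_nonneg (f : Ω → I) {g : Ω → J} (hf : Measurable f) (hg : Measurable g) :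
    0 ≤ condH μ f g :=
  sub_nonneg.2 (partEnt_le_of_factor μ (hf.prodMk hg) fun _ _ h => (Prod.ext_iff.1 h).2)

lemma condH_le_of_factor {f : Ω → I} {g : Ω → J} {h : Ω → K} (hf : Measurable f)
    (hg : Measurable g) (hh : Measurable h) (hgh : ∀ x y, g x = g y → h x = h y) :
    condH μ f g ≤ condH μ f h := by
  have h1 := partEnt_submodular μ hf hg hh
  have h2 : partEnt μ (fun x => (f x, g x, h x)) = partEnt μ (fun x => (f x, g x)) :=
    partEnt_eq_of_factor μ (hf.prodMk (hg.prodMk hh)) (hf.prodMk hg) fun x y => by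
      simp only [Prod.mk.injEq]; have := hgh x y; tauto
  have h3 : partEnt μ (fun x => (g x, h x)) = partEnt μ g :=
    partEnt_eq_of_factor μ (hg.prodMk hh) hg fun x y => by
      simp only [Prod.mk.injEq]; have := hgh x y; tauto
  unfold condH
  linarith

/-- Chain rule. -/
lemma condH_prod {f : Ω → I} {g : Ω → J} {h : Ω → K} (hf : Measurable f)
    (hg : Measurable g) (hh : Measurable h) :
    condH μ (fun x => (f x, g x)) h = condH μ f h + condH μ g (fun x => (f x, h x)) := by
  have h2 : partEnt μ (fun x => (g x, f x, h x)) = partEnt μ (fun x => ((f x, g x), h x)) :=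
    partEnt_eq_of_factor μ (hg.prodMk (hf.prodMk hh)) ((hf.prodMk hg).prodMk hh) fun x y => by
      simp only [Prod.mk.injEq]; tauto
  unfold condH
  linarith

lemma condH_congr_left {f : Ω → I} {f' : Ω → J} {g : Ω → K} (hf : Measurable f)
    (hf' : Measurable f') (hg : Measurable g) (h : ∀ x y, f x = f y ↔ f' x = f' y) :
    condH μ f g = condH μ f' g := by
  unfold condH
  rw [partEnt_eq_of_factor μ (hf.prodMk hg) (hf'.prodMk hg) fun x y => by
      simp only [Prod.mk.injEq, h]]

lemma condH_congr_right {f : Ω → K} {g : Ω → I} {g' : Ω → J} (hf : Measurable f)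
    (hg : Measurable g) (hg' : Measurable g') (h : ∀ x y, g x = g y ↔ g' x = g' y) :
    condH μ f g = condH μ f g' := by
  unfold condH
  rw [partEnt_eq_of_factor μ (hf.prodMk hg) (hf.prodMk hg') fun x y => by
      simp only [Prod.mk.injEq, h], partEnt_eq_of_factor μ hg hg' fun x y => (h x y).symm]

lemma condH_mono_left {f : Ω → I} {f' : Ω → J} {g : Ω → K} (hf' : Measurable f')
    (hg : Measurable g) (h : ∀ x y, f' x = f' y → f x = f y) :
    condH μ f g ≤ condH μ f' g :=
  sub_le_sub_right (partEnt_le_of_factor μ (hf'.prodMk hg) fun x y => by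
    simp only [Prod.mk.injEq]; have := h x y; tauto) _

lemma condH_eq_zero {f : Ω → I} {g : Ω → J} (hf : Measurable f)
    (hg : Measurable g) (h : ∀ x y, g x = g y → f x = f y) : condH μ f g = 0 :=
  sub_eq_zero.2 (partEnt_eq_of_factor μ (hf.prodMk hg) hg fun x y => by
    simp only [Prod.mk.injEq]; have := h x y; tauto)

/-- `H(f) ≤ H(f|g) + H(f|h) + I(g;h)` when `f` is determined by `(g, h)`. -/
lemma partEnt_le_add_condH {f : Ω → I} {g : Ω → J} {h : Ω → K} (hf : Measurable f)
    (hg : Measurable g) (hh : Measurable h)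
    (hd : ∀ x y, g x = g y → h x = h y → f x = f y) :
    partEnt μ f ≤ condH μ f g + condH μ f h
      + (partEnt μ g + partEnt μ h - partEnt μ (fun x => (g x, h x))) := by
  have h1 := partEnt_submodular μ hg hh hf
  have h2 : partEnt μ (fun x => (g x, h x, f x)) = partEnt μ (fun x => (g x, h x)) :=
    partEnt_eq_of_factor μ (hg.prodMk (hh.prodMk hf)) (hg.prodMk hh) fun x y => by
      simp only [Prod.mk.injEq]; have := hd x y; tauto
  have h3 : partEnt μ (fun x => (g x, f x)) = partEnt μ (fun x => (f x, g x)) :=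
    partEnt_eq_of_factor μ (hg.prodMk hf) (hf.prodMk hg) fun x y => by
      simp only [Prod.mk.injEq]; tauto
  have h4 : partEnt μ (fun x => (h x, f x)) = partEnt μ (fun x => (f x, h x)) :=
    partEnt_eq_of_factor μ (hh.prodMk hf) (hf.prodMk hh) fun x y => by
      simp only [Prod.mk.injEq]; tauto
  unfold condH
  linarith

lemma partEnt_comp_measurePreserving {Ω' : Type*} [MeasurableSpace Ω'] {ν : Measure Ω'}
    {T : Ω → Ω'} (hT : MeasurePreserving T μ ν) {f : Ω' → I} (hf : Measurable f) :
    partEnt μ (fun x => f (T x)) = partEnt ν f := by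
  refine Finset.sum_congr rfl fun i _ => ?_
  rw [← hT.measure_preimage (hf (measurableSet_singleton i)).nullMeasurableSet]
  rfl

lemma condH_comp_measurePreserving {Ω' : Type*} [MeasurableSpace Ω'] {ν : Measure Ω'}
    {T : Ω → Ω'} (hT : MeasurePreserving T μ ν) {f : Ω' → I} (hf : Measurable f)
    {g : Ω' → J} (hg : Measurable g) :
    condH μ (fun x => f (T x)) (fun x => g (T x)) = condH ν f g := by
  unfold condH
  rw [partEnt_comp_measurePreserving μ hT hg,
    partEnt_comp_measurePreserving μ hT (f := fun x => (f x, g x)) (hf.prodMk hg)]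

end FiniteEntropy

section ConditionalEntropyFunction

set_option linter.unusedSectionVars false

open Real

variable {Ω : Type*} [mΩ : MeasurableSpace Ω] (μ : Measure Ω) [IsProbabilityMeasure μ]
  {I J : Type*} [Fintype I] [MeasurableSpace I] [MeasurableSingletonClass I]
  [Fintype J] [MeasurableSpace J] [MeasurableSingletonClass J]

/-- The entropy of the conditional distribution of `f` given `{g = v}`. -/
noncomputable def condEntFn (f : Ω → I) (g : Ω → J) (v : J) : ℝ :=
  ∑ i, negMulLog (μ.real (f ⁻¹' {i} ∩ g ⁻¹' {v}) / μ.real (g ⁻¹' {v}))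

lemma condProb_mem_Icc (f : Ω → I) (g : Ω → J) (i : I) (v : J) :
    μ.real (f ⁻¹' {i} ∩ g ⁻¹' {v}) / μ.real (g ⁻¹' {v}) ∈ Icc (0 : ℝ) 1 :=
  ⟨by positivity, div_le_one_of_le₀ (measureReal_mono inter_subset_right) (by positivity)⟩

lemma condEntFn_nonneg (f : Ω → I) (g : Ω → J) (v : J) : 0 ≤ condEntFn μ f g v :=
  Finset.sum_nonneg fun i _ => negMulLog_nonneg (condProb_mem_Icc μ f g i v).1
    (condProb_mem_Icc μ f g i v).2

lemma condEntFn_le_card (f : Ω → I) (g : Ω → J) (v : J) :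
    condEntFn μ f g v ≤ Fintype.card I := by
  calc condEntFn μ f g v ≤ ∑ _i : I, (1 : ℝ) := Finset.sum_le_sum fun i _ => by
        have h := condProb_mem_Icc μ f g i v
        linarith [negMulLog_le_one_sub_self h.1, h.1]
    _ = _ := by simp

lemma condEntFn_comp_measurePreserving {Ω' : Type*} [MeasurableSpace Ω'] {ν : Measure Ω'}
    {T : Ω → Ω'} (hT : MeasurePreserving T μ ν) {f : Ω' → I} (hf : Measurable f)
    {g : Ω' → J} (hg : Measurable g) (v : J) :
    condEntFn μ (fun x => f (T x)) (fun x => g (T x)) v = condEntFn ν f g v := by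
  have h1 : ∀ s, MeasurableSet s → μ.real (T ⁻¹' s) = ν.real s := fun s hs => by
    simp only [measureReal_def, hT.measure_preimage hs.nullMeasurableSet]
  have mg := hg (measurableSet_singleton v)
  unfold condEntFn
  refine Finset.sum_congr rfl fun i _ => ?_
  rw [← h1 _ mg, ← h1 _ ((hf (measurableSet_singleton i)).inter mg)]
  rfl

lemma mul_condEntFn {f : Ω → I} (hf : Measurable f) {g : Ω → J} (hg : Measurable g) (v : J) :
    μ.real (g ⁻¹' {v}) * condEntFn μ f g v
      = ∑ i, negMulLog (μ.real (f ⁻¹' {i} ∩ g ⁻¹' {v})) - negMulLog (μ.real (g ⁻¹' {v})) := by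
  have hsum : μ.real (g ⁻¹' {v}) = ∑ i, μ.real (f ⁻¹' {i} ∩ g ⁻¹' {v}) := by
    rw [real_preimage_eq_sum μ hf (hg (measurableSet_singleton v))]
    exact Finset.sum_congr rfl fun i _ => by rw [inter_comm]
  set P := μ.real (g ⁻¹' {v}) with hP
  rcases (measureReal_nonneg : 0 ≤ μ.real (g ⁻¹' {v})).eq_or_lt with h | h
  · have h0 : ∀ i, μ.real (f ⁻¹' {i} ∩ g ⁻¹' {v}) = 0 := fun i =>
      le_antisymm ((measureReal_mono inter_subset_right).trans h.ge) measureReal_nonneg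
    rw [← hP] at h
    simp [h0, ← h]
  · rw [← hP] at h
    have h1 : ∀ i, P * negMulLog (μ.real (f ⁻¹' {i} ∩ g ⁻¹' {v}) / P)
        = negMulLog (μ.real (f ⁻¹' {i} ∩ g ⁻¹' {v}))
          + μ.real (f ⁻¹' {i} ∩ g ⁻¹' {v}) * log P := by
      intro i
      rcases (measureReal_nonneg : 0 ≤ μ.real (f ⁻¹' {i} ∩ g ⁻¹' {v})).eq_or_lt with h' | h'
      · simp [← h']
      · simp only [negMulLog]
        rw [log_div h'.ne' h.ne']
        field_simp
        ring
    unfold condEntFn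
    rw [Finset.mul_sum, Finset.sum_congr rfl fun i _ => h1 i, Finset.sum_add_distrib,
      ← Finset.sum_mul, ← hsum]
    simp [negMulLog]

lemma integral_comp_eq_sum {g : Ω → J} (hg : Measurable g) (φ : J → ℝ) :
    ∫ x, φ (g x) ∂μ = ∑ v, μ.real (g ⁻¹' {v}) * φ v := by
  have := Measure.isProbabilityMeasure_map (μ := μ) hg.aemeasurable
  rw [← integral_map (φ := g) hg.aemeasurable (f := φ)
    (Measurable.of_discrete).aestronglyMeasurable, integral_fintype]
  · refine Finset.sum_congr rfl fun v _ => ?_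
    rw [map_measureReal_apply hg (measurableSet_singleton v), smul_eq_mul]
  · exact Integrable.of_finite

lemma condH_eq_integral {f : Ω → I} (hf : Measurable f) {g : Ω → J} (hg : Measurable g) :
    condH μ f g = ∫ x, condEntFn μ f g (g x) ∂μ := by
  rw [integral_comp_eq_sum μ hg, Finset.sum_congr rfl fun v _ => mul_condEntFn μ hf hg v,
    Finset.sum_sub_distrib]
  simp only [condH, partEnt_eq, Fintype.sum_prod_type_right, prod_preimage]

lemma condProb_ae_eq_condExp {f : Ω → I} (hf : Measurable f) {g : Ω → J} (hg : Measurable g)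
    (i : I) :
    (fun x => μ.real (f ⁻¹' {i} ∩ g ⁻¹' {g x}) / μ.real (g ⁻¹' {g x}))
      =ᵐ[μ] μ[(f ⁻¹' {i}).indicator (fun _ => (1 : ℝ)) |
        MeasurableSpace.comap g inferInstance] := by
  set φ : J → ℝ := fun v => μ.real (f ⁻¹' {i} ∩ g ⁻¹' {v}) / μ.real (g ⁻¹' {v}) with hφ
  have mf := hf (measurableSet_singleton i)
  have hφi : Integrable (fun x => φ (g x)) μ :=
    Integrable.of_bound ((Measurable.of_discrete (f := φ)).comp hg).aestronglyMeasurable 1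
      (Eventually.of_forall fun x => by
        have h := condProb_mem_Icc μ f g i (g x)
        rw [Real.norm_eq_abs, abs_of_nonneg h.1]; exact h.2)
  refine ae_eq_condExp_of_forall_setIntegral_eq hg.comap_le
    ((integrable_const (1 : ℝ)).indicator mf) (fun s _ _ => hφi.integrableOn) ?_ ?_
  · rintro s ⟨t, ht, rfl⟩ -
    classical
    rw [integral_indicator mf, Measure.restrict_restrict mf, setIntegral_const,
      ← integral_indicator (hg ht)]
    have h1 : (g ⁻¹' t).indicator (fun x => φ (g x))
        = fun x => (t.indicator φ) (g x) := by
      ext x; by_cases h : g x ∈ t <;> simp [h]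
    rw [h1, integral_comp_eq_sum μ hg, real_preimage_eq_sum μ hg (mf.inter (hg ht)),
      smul_eq_mul, mul_one]
    refine Finset.sum_congr rfl fun v _ => ?_
    by_cases hv : v ∈ t
    · rw [indicator_of_mem hv, hφ]
      have h2 : f ⁻¹' {i} ∩ g ⁻¹' t ∩ g ⁻¹' {v} = f ⁻¹' {i} ∩ g ⁻¹' {v} := by
        ext x; simp only [mem_inter_iff, mem_preimage, mem_singleton_iff]
        constructor
        · tauto
        · rintro ⟨h, h'⟩; exact ⟨⟨h, h' ▸ hv⟩, h'⟩
      rw [h2]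
      rcases (measureReal_nonneg : 0 ≤ μ.real (g ⁻¹' {v})).eq_or_lt with h | h
      · have h0 : μ.real (f ⁻¹' {i} ∩ g ⁻¹' {v}) = 0 :=
          le_antisymm ((measureReal_mono inter_subset_right).trans h.ge) measureReal_nonneg
        simp [h0, ← h]
      · field_simp
    · rw [indicator_of_notMem hv, mul_zero]
      have h2 : f ⁻¹' {i} ∩ g ⁻¹' t ∩ g ⁻¹' {v} = ∅ := by
        ext x; simp only [mem_inter_iff, mem_preimage, mem_singleton_iff, mem_empty_iff_false,
          iff_false]
        rintro ⟨⟨-, h⟩, h'⟩; exact hv (h' ▸ h)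
      simp [h2]
  · exact (((Measurable.of_discrete (f := φ)).comp
      (comap_measurable g)).stronglyMeasurable).aestronglyMeasurable

/-- The entropy function of `f` conditionally on a σ-algebra `m`. -/
noncomputable def condEntAlg (f : Ω → I) (m : MeasurableSpace Ω) (x : Ω) : ℝ :=
  ∑ i, negMulLog ((μ[(f ⁻¹' {i}).indicator (fun _ => (1 : ℝ)) | m]) x)

lemma measurable_condEntAlg (f : Ω → I) (ℱ : Filtration ℕ mΩ) :
    Measurable (condEntAlg μ f (⨆ l, ℱ l)) :=
  Finset.measurable_fun_sum _ fun _ _ => continuous_negMulLog.measurable.comp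
    ((stronglyMeasurable_condExp.mono (iSup_le ℱ.le)).measurable)

variable {L : ℕ → Type*} [∀ l, Fintype (L l)] [∀ l, MeasurableSpace (L l)]
  [∀ l, MeasurableSingletonClass (L l)]

lemma tendsto_condEntFn {f : Ω → I} (hf : Measurable f) {V : ∀ l, Ω → L l}
    (hV : ∀ l, Measurable (V l)) (ℱ : Filtration ℕ mΩ)
    (hℱ : ∀ l, ℱ l = MeasurableSpace.comap (V l) inferInstance) :
    ∀ᵐ x ∂μ, Tendsto (fun l => condEntFn μ f (V l) (V l x)) atTop
      (𝓝 (condEntAlg μ f (⨆ l, ℱ l) x)) := by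
  have h1 : ∀ᵐ x ∂μ, ∀ i : I, ∀ l, μ.real (f ⁻¹' {i} ∩ V l ⁻¹' {V l x}) / μ.real (V l ⁻¹' {V l x})
      = (μ[(f ⁻¹' {i}).indicator (fun _ => (1 : ℝ)) | ℱ l]) x := by
    rw [ae_all_iff]; intro i; rw [ae_all_iff]; intro l
    rw [hℱ l]
    exact condProb_ae_eq_condExp μ hf (hV l) i
  have h2 : ∀ᵐ x ∂μ, ∀ i : I, Tendsto
      (fun l => (μ[(f ⁻¹' {i}).indicator (fun _ => (1 : ℝ)) | ℱ l]) x) atTop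
      (𝓝 ((μ[(f ⁻¹' {i}).indicator (fun _ => (1 : ℝ)) | ⨆ l, ℱ l]) x)) := by
    rw [ae_all_iff]; intro i
    exact tendsto_ae_condExp _
  filter_upwards [h1, h2] with x hx1 hx2
  unfold condEntFn condEntAlg
  refine tendsto_finsetSum _ fun i _ => ?_
  simp_rw [hx1 i]
  exact (continuous_negMulLog.tendsto _).comp (hx2 i)

lemma condEntAlg_mem_Icc {f : Ω → I} (hf : Measurable f) {V : ∀ l, Ω → L l}
    (hV : ∀ l, Measurable (V l)) (ℱ : Filtration ℕ mΩ)
    (hℱ : ∀ l, ℱ l = MeasurableSpace.comap (V l) inferInstance) :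
    ∀ᵐ x ∂μ, condEntAlg μ f (⨆ l, ℱ l) x ∈ Icc (0 : ℝ) (Fintype.card I) := by
  filter_upwards [tendsto_condEntFn μ hf hV ℱ hℱ] with x hx
  exact isClosed_Icc.mem_of_tendsto hx (Eventually.of_forall fun l =>
    ⟨condEntFn_nonneg .., condEntFn_le_card ..⟩)

lemma tendsto_condH {f : Ω → I} (hf : Measurable f) {V : ∀ l, Ω → L l}
    (hV : ∀ l, Measurable (V l)) (ℱ : Filtration ℕ mΩ)
    (hℱ : ∀ l, ℱ l = MeasurableSpace.comap (V l) inferInstance) :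
    Tendsto (fun l => condH μ f (V l)) atTop (𝓝 (∫ x, condEntAlg μ f (⨆ l, ℱ l) x ∂μ)) := by
  simp_rw [fun l => condH_eq_integral μ hf (hV l)]
  refine tendsto_integral_of_dominated_convergence (fun _ => (Fintype.card I : ℝ)) (fun l => ?_)
    (integrable_const _) (fun l => Eventually.of_forall fun x => ?_)
    (tendsto_condEntFn μ hf hV ℱ hℱ)
  · exact ((Measurable.of_discrete (f := condEntFn μ f (V l))).comp
      (hV l)).aestronglyMeasurable
  · rw [Real.norm_eq_abs, abs_of_nonneg (condEntFn_nonneg ..)]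
    exact condEntFn_le_card ..

/-- If the σ-algebras generated by the `V l` increase to the full σ-algebra, then
`H(f | V l) → 0`. -/
lemma tendsto_condH_zero {f : Ω → I} (hf : Measurable f) {V : ∀ l, Ω → L l}
    (hV : ∀ l, Measurable (V l)) (ℱ : Filtration ℕ mΩ)
    (hℱ : ∀ l, ℱ l = MeasurableSpace.comap (V l) inferInstance) (htop : ⨆ l, ℱ l = mΩ) :
    Tendsto (fun l => condH μ f (V l)) atTop (𝓝 0) := by
  have h := tendsto_condH μ hf hV ℱ hℱ
  have h0 : ∫ x, condEntAlg μ f (⨆ l, ℱ l) x ∂μ = 0 := by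
    rw [htop]
    refine integral_eq_zero_of_ae (Eventually.of_forall fun x => ?_)
    refine Finset.sum_eq_zero fun i _ => ?_
    have mf := hf (measurableSet_singleton i)
    rw [condExp_of_stronglyMeasurable le_rfl
      ((stronglyMeasurable_const (β := ℝ)).indicator mf)
      ((integrable_const (1 : ℝ)).indicator mf)]
    by_cases hx : x ∈ f ⁻¹' {i}
    · rw [indicator_of_mem hx, negMulLog_one]
    · rw [indicator_of_notMem hx, negMulLog_zero]
  rwa [h0] at h

end ConditionalEntropyFunction

section InformationGain

set_option linter.unusedSectionVars false

open Real

variable {Ω : Type*} [mΩ : MeasurableSpace Ω] (μ : Measure Ω) [IsProbabilityMeasure μ]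
  {I J K : Type*} [Fintype I] [MeasurableSpace I] [MeasurableSingletonClass I]
  [Fintype J] [MeasurableSpace J] [MeasurableSingletonClass J]
  [Fintype K] [MeasurableSpace K] [MeasurableSingletonClass K]

lemma sum_fiber_ite {c : Ω → K} {s : Set Ω} {c₀ : K}
    (h : ∀ᵐ x ∂μ, x ∈ s → c x = c₀) :
    ∑ k, negMulLog (μ.real (c ⁻¹' {k} ∩ s)) = negMulLog (μ.real s) := by
  rw [Finset.sum_eq_single c₀]
  · congr 1
    refine measureReal_congr ?_
    filter_upwards [h] with x hx
    refine propext ⟨fun hh => hh.2, fun hh => ⟨hx hh, hh⟩⟩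
  · intro k _ hk
    have : μ.real (c ⁻¹' {k} ∩ s) = 0 := by
      rw [measureReal_def, measure_eq_zero_iff_ae_notMem.2, ENNReal.toReal_zero]
      filter_upwards [h] with x hx hx'
      exact hk (hx'.1.symm.trans (hx hx'.2))
    rw [this, negMulLog_zero]
  · simp

/-- The information on `c` gained by observing `b` in addition to `g` is at most the conditional
entropy of `b` on the part of the space where `g` does not already determine `c`. -/
lemma condH_sub_condH_le {c : Ω → K} (hc : Measurable c) {b : Ω → I} (hb : Measurable b)
    {g : Ω → J} (hg : Measurable g) (D : Set J)
    (hD : ∀ v ∈ D, ∃ c₀, ∀ᵐ x ∂μ, g x = v → c x = c₀) :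
    condH μ c g - condH μ c (fun x => (b x, g x))
      ≤ ∫ x, Dᶜ.indicator (condEntFn μ b g) (g x) ∂μ := by
  classical
  rw [integral_comp_eq_sum μ hg]
  have e1 : condH μ c g = ∑ v, (∑ k, negMulLog (μ.real (c ⁻¹' {k} ∩ g ⁻¹' {v}))
      - negMulLog (μ.real (g ⁻¹' {v}))) := by
    simp only [condH, partEnt_eq, Fintype.sum_prod_type_right, prod_preimage,
      Finset.sum_sub_distrib]
  have e2 : condH μ c (fun x => (b x, g x))
      = ∑ v, (∑ i, ∑ k, negMulLog (μ.real (c ⁻¹' {k} ∩ (b ⁻¹' {i} ∩ g ⁻¹' {v})))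
      - ∑ i, negMulLog (μ.real (b ⁻¹' {i} ∩ g ⁻¹' {v}))) := by
    simp only [condH, partEnt_eq, Fintype.sum_prod_type_right, prod_preimage,
      Finset.sum_sub_distrib]
  rw [e1, e2, ← Finset.sum_sub_distrib]
  refine Finset.sum_le_sum fun v _ => ?_
  by_cases hv : v ∈ D
  · obtain ⟨c₀, h⟩ := hD v hv
    rw [sum_fiber_ite μ (s := g ⁻¹' {v}) (c₀ := c₀) h, Finset.sum_congr rfl fun i _ =>
      sum_fiber_ite μ (c₀ := c₀) (h.mono fun x hx (hx' : x ∈ b ⁻¹' {i} ∩ g ⁻¹' {v}) => hx hx'.2)]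
    simp [hv]
  · rw [indicator_of_mem (by simpa using hv), mul_condEntFn μ hb hg]
    have h : ∑ k, negMulLog (μ.real (c ⁻¹' {k} ∩ g ⁻¹' {v}))
        ≤ ∑ i, ∑ k, negMulLog (μ.real (c ⁻¹' {k} ∩ (b ⁻¹' {i} ∩ g ⁻¹' {v}))) := by
      rw [Finset.sum_comm]
      refine Finset.sum_le_sum fun k _ => ?_
      rw [real_preimage_eq_sum μ hb ((hc (measurableSet_singleton k)).inter
        (hg (measurableSet_singleton v)))]
      refine (negMulLog_sum_le _ _ fun _ => measureReal_nonneg).trans (le_of_eq ?_)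
      refine Finset.sum_congr rfl fun i _ => ?_
      congr 2; ext x; simp; tauto
    linarith

end InformationGain

section MeanErgodic

variable {Ω : Type*} [mΩ : MeasurableSpace Ω] (μ : Measure Ω) [IsProbabilityMeasure μ]

open Real

/-- The mean ergodic theorem in `L¹`. -/
lemma tendsto_integral_abs_birkhoffSum {T : Ω → Ω} (hT : Ergodic T μ) {g : Ω → ℝ}
    (hg : MemLp g 2 μ) :
    Tendsto (fun n : ℕ => (∫ x, |∑ k ∈ Finset.range n, g (T^[k] x) - n * ∫ x, g x ∂μ| ∂μ) / n)
      atTop (𝓝 0) := by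
  have hTm := hT.toMeasurePreserving
  set U : Lp ℝ 2 μ →L[ℝ] Lp ℝ 2 μ :=
    (Lp.compMeasurePreservingₗᵢ ℝ T hTm).toContinuousLinearMap with hU
  have hU1 : ‖U‖ ≤ 1 := LinearIsometry.norm_toContinuousLinearMap_le _
  set G : Lp ℝ 2 μ := hg.toLp g with hG
  have hlim := U.tendsto_birkhoffAverage_orthogonalProjection hU1 G
  set P := (U.eqLocus (1 : Lp ℝ 2 μ →L[ℝ] Lp ℝ 2 μ)).orthogonalProjectionOnto G with hP
  have hPU : U (P : Lp ℝ 2 μ) = P := P.2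
  obtain ⟨c, hc⟩ : ∃ c, (P : Lp ℝ 2 μ) =ᵐ[μ] Function.const Ω c := by
    refine hT.ae_eq_const_of_ae_eq_comp_ae (Lp.aestronglyMeasurable _) ?_
    have h1 := Lp.coeFn_compMeasurePreserving (P : Lp ℝ 2 μ) hTm
    have h2 : Lp.compMeasurePreserving T hTm (P : Lp ℝ 2 μ) = P := hPU
    rw [h2] at h1
    exact h1.symm
  have hgk : ∀ k, MemLp (fun x => g (T^[k] x)) 2 μ := fun k =>
    hg.comp_measurePreserving (hTm.iterate k)
  have hUk : ∀ k, U^[k] G = (hgk k).toLp _ := by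
    intro k
    have : ⇑U = Lp.compMeasurePreserving T hTm := rfl
    rw [this, Lp.compMeasurePreserving_iterate]
    rfl
  have hS : ∀ n, ∀ᵐ x ∂μ, (∑ k ∈ Finset.range n, U^[k] G : Lp ℝ 2 μ) x
      = ∑ k ∈ Finset.range n, g (T^[k] x) := by
    intro n
    induction n with
    | zero =>
      filter_upwards [Lp.coeFn_zero ℝ 2 μ] with x hx
      simp
    | succ n ih =>
      filter_upwards [ih, Lp.coeFn_add (∑ k ∈ Finset.range n, U^[k] G) (U^[n] G),
        (hgk n).coeFn_toLp] with x h1 h2 h3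
      rw [Finset.sum_range_succ, Finset.sum_range_succ, h2, Pi.add_apply, h1, hUk n, h3]
  have hA : ∀ n : ℕ, (birkhoffAverage ℝ U _root_.id n G - P : Lp ℝ 2 μ)
      =ᵐ[μ] fun x => (n : ℝ)⁻¹ * ∑ k ∈ Finset.range n, g (T^[k] x) - c := by
    intro n
    filter_upwards [hS n, hc, Lp.coeFn_sub (birkhoffAverage ℝ U _root_.id n G) (P : Lp ℝ 2 μ),
      Lp.coeFn_smul ((n : ℝ)⁻¹) (∑ k ∈ Finset.range n, U^[k] G : Lp ℝ 2 μ)] with x h1 h2 h3 h4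
    rw [h3, Pi.sub_apply, h2]
    have : birkhoffAverage ℝ U _root_.id n G
      = (n : ℝ)⁻¹ • (∑ k ∈ Finset.range n, U^[k] G : Lp ℝ 2 μ) := rfl
    rw [this, h4, Pi.smul_apply, h1]
    rfl
  have hL1 : ∀ f : Lp ℝ 2 μ, ∫ x, |f x| ∂μ ≤ ‖f‖ := by
    intro f
    have h1 : ∫ x, |f x| ∂μ = (eLpNorm f 1 μ).toReal := by
      simp_rw [← Real.norm_eq_abs]
      rw [integral_norm_eq_lintegral_enorm (Lp.aestronglyMeasurable f),
        eLpNorm_one_eq_lintegral_enorm]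
    rw [h1, Lp.norm_def]
    exact ENNReal.toReal_mono (Lp.eLpNorm_ne_top f)
      (eLpNorm_le_eLpNorm_of_exponent_le (by norm_num) (Lp.aestronglyMeasurable f))
  have hint : ∀ n : ℕ, Integrable (fun x => ∑ k ∈ Finset.range n, g (T^[k] x)) μ := fun n =>
    integrable_finsetSum _ fun k _ => (hgk k).integrable (by norm_num)
  have hlim0 : Tendsto (fun n : ℕ =>
      ∫ x, |(n : ℝ)⁻¹ * ∑ k ∈ Finset.range n, g (T^[k] x) - c| ∂μ) atTop (𝓝 0) := by
    refine squeeze_zero (fun n => integral_nonneg fun x => abs_nonneg _) (fun n => ?_)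
      (tendsto_iff_norm_sub_tendsto_zero.1 hlim)
    refine le_trans (le_of_eq ?_) (hL1 _)
    refine integral_congr_ae ?_
    filter_upwards [hA n] with x hx
    exact congrArg abs hx.symm
  have hmean : ∀ n : ℕ, n ≠ 0 →
      ∫ x, (n : ℝ)⁻¹ * ∑ k ∈ Finset.range n, g (T^[k] x) ∂μ = ∫ x, g x ∂μ := by
    intro n hn
    rw [integral_const_mul, integral_finsetSum _ fun k _ => (hgk k).integrable (by norm_num)]
    have : ∀ k, ∫ x, g (T^[k] x) ∂μ = ∫ x, g x ∂μ := fun k => by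
      have hk := hTm.iterate k
      have h := integral_map (μ := μ) (φ := T^[k]) hk.measurable.aemeasurable (f := g)
        (by rw [hk.map_eq]; exact hg.aestronglyMeasurable)
      rw [hk.map_eq] at h
      exact h.symm
    simp_rw [this]
    rw [Finset.sum_const, Finset.card_range, nsmul_eq_mul]
    field_simp
  have hcg : c = ∫ x, g x ∂μ := by
    have h : ∀ᶠ n : ℕ in atTop, |∫ x, g x ∂μ - c|
        ≤ ∫ x, |(n : ℝ)⁻¹ * ∑ k ∈ Finset.range n, g (T^[k] x) - c| ∂μ := by
      filter_upwards [eventually_ne_atTop 0] with n hn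
      have := abs_integral_le_integral_abs (μ := μ)
        (f := fun x => (n : ℝ)⁻¹ * ∑ k ∈ Finset.range n, g (T^[k] x) - c)
      rwa [integral_sub ((hint n).const_mul _) (integrable_const c), hmean n hn,
        integral_const, probReal_univ, one_smul] at this
    have h2 := ge_of_tendsto hlim0 h
    have h3 := abs_eq_zero.1 (le_antisymm h2 (abs_nonneg _))
    linarith
  refine hlim0.congr' ?_
  filter_upwards [eventually_ne_atTop 0] with n hn
  rw [← integral_div]
  congr 1
  ext x
  have hn' : (0 : ℝ) < n := by positivity
  have e : ∑ k ∈ Finset.range n, g (T^[k] x) - n * c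
      = n * ((n : ℝ)⁻¹ * ∑ k ∈ Finset.range n, g (T^[k] x) - c) := by field_simp
  rw [← hcg, e, abs_mul, abs_of_pos hn']
  field_simp

end MeanErgodic

section Windows

variable {A : Type*}

/-- The word `x_i ⋯ x_{i+m-1}`. -/
def win (i : ℤ) (m : ℕ) (x : ℤ → A) : Fin m → A := fun j => x (i + ((j : ℕ) : ℤ))

/-- The space-time block of width `w` and height `n + 1` with lower left corner at `(i, 0)`. -/
def col (F : (ℤ → A) → ℤ → A) (i : ℤ) (w n : ℕ) (x : ℤ → A) : Fin (n + 1) → Fin w → A :=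
  fun t => win i w (F^[t] x)

lemma win_eq_iff {i : ℤ} {m : ℕ} {x y : ℤ → A} :
    win i m x = win i m y ↔ ∀ k, i ≤ k → k < i + m → x k = y k := by
  constructor
  · intro h k h1 h2
    have := congrFun h ⟨(k - i).toNat, by omega⟩
    simp only [win] at this
    rwa [show i + (((k - i).toNat : ℕ) : ℤ) = k by omega] at this
  · exact fun h => funext fun j => h _ (by omega) (by omega)

lemma col_eq_iff {F : (ℤ → A) → ℤ → A} {i : ℤ} {w n : ℕ} {x y : ℤ → A} :
    col F i w n x = col F i w n y ↔
      ∀ t ≤ n, ∀ k, i ≤ k → k < i + w → F^[t] x k = F^[t] y k := by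
  constructor
  · intro h t ht
    exact win_eq_iff.1 (congrFun h ⟨t, by omega⟩)
  · exact fun h => funext fun t => win_eq_iff.2 (h t (by omega))

lemma win_shiftIter (i j : ℤ) (m : ℕ) (x : ℤ → A) :
    win i m (shiftIter j x) = win (i + j) m x := by
  funext k; simp only [win, shiftIter]; congr 1; ring

lemma shiftIter_shiftIter (i j : ℤ) (x : ℤ → A) :
    shiftIter i (shiftIter j x) = shiftIter (i + j) x := by
  funext k; simp only [shiftIter]; congr 1; ring

lemma shiftIter_zero (x : ℤ → A) : shiftIter 0 x = x := by
  funext k; simp [shiftIter]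

lemma iterate_shiftIter (j : ℤ) (n : ℕ) (x : ℤ → A) :
    (shiftIter j)^[n] x = shiftIter (n * j) x := by
  induction n with
  | zero => simp [shiftIter_zero]
  | succ n ih => rw [Function.iterate_succ_apply', ih, shiftIter_shiftIter]; congr 1; push_cast; ring

lemma shiftIter_one : shiftIter (A := A) 1 = shiftMap A := rfl

/-- The shift by `j` as a measurable equivalence. -/
def shiftEquiv (A : Type*) [MeasurableSpace A] (j : ℤ) : (ℤ → A) ≃ᵐ (ℤ → A) where
  toFun := shiftIter j
  invFun := shiftIter (-j)
  left_inv x := by rw [shiftIter_shiftIter, neg_add_cancel, shiftIter_zero]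
  right_inv x := by rw [shiftIter_shiftIter, add_neg_cancel, shiftIter_zero]
  measurable_toFun := measurable_pi_lambda _ fun i => measurable_pi_apply _
  measurable_invFun := measurable_pi_lambda _ fun i => measurable_pi_apply _

lemma commute_shiftIter {F : (ℤ → A) → ℤ → A}
    (hF : ∀ x, F (shiftMap A x) = shiftMap A (F x)) (j : ℤ) (x : ℤ → A) :
    F (shiftIter j x) = shiftIter j (F x) := by
  have h1 : ∀ n : ℕ, ∀ x, F (shiftIter n x) = shiftIter n (F x) := by
    intro n x
    have := (Function.Semiconj.iterate_right (f := F) (ga := shiftMap A) (gb := shiftMap A) hF n) x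
    rw [← shiftIter_one, iterate_shiftIter, iterate_shiftIter, mul_one] at this
    exact this
  obtain ⟨n, rfl | rfl⟩ := j.eq_nat_or_neg
  · exact h1 n x
  · have := h1 n (shiftIter (-n) x)
    rw [shiftIter_shiftIter, add_neg_cancel, shiftIter_zero] at this
    rw [this, shiftIter_shiftIter, neg_add_cancel, shiftIter_zero]

lemma iterate_commute_shiftIter {F : (ℤ → A) → ℤ → A}
    (hF : ∀ x, F (shiftMap A x) = shiftMap A (F x)) (j : ℤ) (n : ℕ) (x : ℤ → A) :
    F^[n] (shiftIter j x) = shiftIter j (F^[n] x) :=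
  Function.Commute.iterate_left (f := F) (g := shiftIter j) (commute_shiftIter hF j) n x

lemma col_shiftIter {F : (ℤ → A) → ℤ → A}
    (hF : ∀ x, F (shiftMap A x) = shiftMap A (F x)) (i j : ℤ) (w n : ℕ) (x : ℤ → A) :
    col F i w n (shiftIter j x) = col F (i + j) w n x := by
  funext t
  simp only [col, iterate_commute_shiftIter hF, win_shiftIter]

lemma mapsTo_shiftIter {X : Set (ℤ → A)} (hX : shiftMap A '' X = X) (j : ℤ) :
    MapsTo (shiftIter j) X X := by
  have h1 : ∀ n : ℕ, MapsTo (shiftIter (n : ℤ)) X X := by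
    intro n x hx
    have h : MapsTo (shiftMap A) X X := fun x hx => hX ▸ mem_image_of_mem _ hx
    have := h.iterate n hx
    rwa [← shiftIter_one, iterate_shiftIter, mul_one] at this
  have h2 : ∀ n : ℕ, MapsTo (shiftIter (-(n : ℤ))) X X := by
    intro n
    induction n with
    | zero => exact h1 0
    | succ n ih =>
      intro x hx
      obtain ⟨y, hy, rfl⟩ := hX.symm ▸ hx
      rw [← shiftIter_one, shiftIter_shiftIter]
      convert ih hy using 2
      push_cast; ring
  obtain ⟨n, rfl | rfl⟩ := j.eq_nat_or_neg
  · exact h1 n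
  · exact h2 n

/-- `F(x)_i` depends only on the coordinates of `x` in `[i - r, i + r]`. -/
def DependsWithin (F : (ℤ → A) → ℤ → A) (r : ℕ) : Prop :=
  ∀ (x y : ℤ → A) (i : ℤ), (∀ k, i - r ≤ k → k ≤ i + r → x k = y k) → F x i = F y i

lemma HasLocalRule.dependsWithin {F : (ℤ → A) → ℤ → A} {r : ℕ} (h : HasLocalRule F r) :
    DependsWithin F r := by
  obtain ⟨f, hf⟩ := h
  intro x y i hxy
  rw [hf, hf]
  congr 1
  funext j
  exact hxy _ (by omega) (by omega)

lemma DependsWithin.iterate {F : (ℤ → A) → ℤ → A} {r : ℕ} (h : DependsWithin F r) (n : ℕ) :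
    DependsWithin F^[n] (r * n) := by
  induction n with
  | zero => exact fun x y i hxy => hxy i (by simp) (by simp)
  | succ n ih =>
    intro x y i hxy
    rw [Function.iterate_succ_apply, Function.iterate_succ_apply]
    refine ih _ _ _ fun k h1 h2 => h _ _ _ fun l h3 h4 => hxy l ?_ ?_ <;>
    · push_cast at *; linarith

variable [Fintype A] [MeasurableSpace A] [MeasurableSingletonClass A]

set_option linter.unusedSectionVars false

lemma measurable_win (i : ℤ) (m : ℕ) : Measurable (win (A := A) i m) :=
  measurable_pi_lambda _ fun _ => measurable_pi_apply _

lemma measurable_col {F : (ℤ → A) → ℤ → A} (hF : Measurable F) (i : ℤ) (w n : ℕ) :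
    Measurable (col F i w n) :=
  measurable_pi_lambda _ fun t => (measurable_win i w).comp (hF.iterate t)

lemma measurePreserving_shiftIter {μ : Measure (ℤ → A)}
    (hσ : MeasurePreserving (shiftMap A) μ μ) (j : ℤ) : MeasurePreserving (shiftIter j) μ μ := by
  have h1 : ∀ n : ℕ, MeasurePreserving (shiftIter (A := A) n) μ μ := fun n => by
    have h := hσ.iterate n
    rw [← shiftIter_one] at h
    convert h using 1
    funext x
    rw [iterate_shiftIter, mul_one]
  obtain ⟨n, rfl | rfl⟩ := j.eq_nat_or_neg
  · exact h1 n
  · exact MeasurePreserving.symm (shiftEquiv A n) (h1 n)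

end Windows

section WindowEntropy

set_option linter.unusedSectionVars false

variable {A : Type*} [Fintype A] [MeasurableSpace A] [MeasurableSingletonClass A]
  (μ : Measure (ℤ → A)) [IsProbabilityMeasure μ]

lemma partEnt_win (hσ : MeasurePreserving (shiftMap A) μ μ) (i : ℤ) (m : ℕ) :
    partEnt μ (win i m) = partEnt μ (win 0 m) := by
  rw [← partEnt_comp_measurePreserving μ (measurePreserving_shiftIter hσ i) (measurable_win 0 m)]
  congr 1
  funext x
  rw [win_shiftIter, zero_add]

lemma comap_win_mono {i j : ℤ} {l m : ℕ} (h1 : j ≤ i) (h2 : i + l ≤ j + m) :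
    MeasurableSpace.comap (win (A := A) i l) inferInstance
      ≤ MeasurableSpace.comap (win (A := A) j m) inferInstance := by
  let φ : (Fin m → A) → Fin l → A := fun u k => u ⟨(i + ((k : ℕ) : ℤ) - j).toNat, by omega⟩
  have hφ : Measurable φ := measurable_pi_lambda _ fun k => measurable_pi_apply _
  have h : win (A := A) i l = φ ∘ win j m := by
    funext x k
    simp only [win, φ, Function.comp]
    congr 1
    omega
  rw [h, ← MeasurableSpace.comap_comp]
  exact MeasurableSpace.comap_mono hφ.comap_le

/-- The filtration generated by the words `x_0 ⋯ x_{l-1}`. -/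
def winFiltration (A : Type*) [Fintype A] [MeasurableSpace A] [MeasurableSingletonClass A] :
    Filtration ℕ (MeasurableSpace.pi : MeasurableSpace (ℤ → A)) where
  seq l := MeasurableSpace.comap (win 0 l) inferInstance
  mono' l m hlm := comap_win_mono le_rfl (by omega)
  le' l := Measurable.comap_le (measurable_pi_lambda _ fun _ => measurable_pi_apply _)

/-- The entropy of the conditional distribution of `x_{-1}` given `x_0, x_1, …`. -/
noncomputable def futureEnt (x : ℤ → A) : ℝ :=
  condEntAlg μ (fun x : ℤ → A => x (-1)) (⨆ l, winFiltration A l) x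

/-- The entropy rate of the shift with respect to the zero-coordinate partition. -/
noncomputable def entRate : ℝ := ∫ x, futureEnt μ x ∂μ

lemma measurable_futureEnt : Measurable (futureEnt μ) :=
  measurable_condEntAlg μ _ (winFiltration A)

lemma futureEnt_mem_Icc : ∀ᵐ x ∂μ, futureEnt μ x ∈ Icc (0 : ℝ) (Fintype.card A) :=
  condEntAlg_mem_Icc μ (measurable_pi_apply _) (measurable_win 0) (winFiltration A) fun _ => rfl

lemma condH_win (hσ : MeasurePreserving (shiftMap A) μ μ) (l : ℕ) :
    condH μ (fun x : ℤ → A => x (-1)) (win 0 l)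
      = partEnt μ (win 0 (l + 1)) - partEnt μ (win 0 l) := by
  rw [condH, ← partEnt_win μ hσ (-1) (l + 1)]
  congr 1
  refine partEnt_eq_of_factor μ ((measurable_pi_apply _).prodMk (measurable_win 0 l))
    (measurable_win _ _) fun x y => ?_
  rw [Prod.mk.injEq, win_eq_iff, win_eq_iff]
  refine ⟨fun h => ⟨h _ le_rfl (by omega), fun k h1 h2 => h k (by omega) (by omega)⟩,
    fun h k h1 h2 => ?_⟩
  rcases eq_or_ne k (-1) with rfl | hk
  · exact h.1
  · exact h.2 k (by omega) (by push_cast at h2; omega)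

lemma tendsto_partEnt_win_sub (hσ : MeasurePreserving (shiftMap A) μ μ) :
    Tendsto (fun l => partEnt μ (win (A := A) 0 (l + 1)) - partEnt μ (win (A := A) 0 l)) atTop
      (𝓝 (entRate μ)) := by
  simp_rw [← condH_win μ hσ]
  exact tendsto_condH μ (measurable_pi_apply _) (measurable_win 0) (winFiltration A) fun _ => rfl

lemma entRate_le_partEnt_win_sub (hσ : MeasurePreserving (shiftMap A) μ μ) (l : ℕ) :
    entRate μ ≤ partEnt μ (win (A := A) 0 (l + 1)) - partEnt μ (win (A := A) 0 l) := by
  refine Antitone.le_of_tendsto (f := fun l => partEnt μ (win (A := A) 0 (l + 1))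
    - partEnt μ (win (A := A) 0 l)) (fun l m hlm => ?_) (tendsto_partEnt_win_sub μ hσ) l
  simp only [← condH_win μ hσ]
  refine condH_le_of_factor μ (measurable_pi_apply _) (measurable_win 0 m) (measurable_win 0 l)
    fun x y h => ?_
  rw [win_eq_iff] at h ⊢
  exact fun k h1 h2 => h k h1 (by omega)

lemma entRate_nonneg : 0 ≤ entRate μ :=
  integral_nonneg_of_ae ((futureEnt_mem_Icc μ).mono fun _ h => h.1)

lemma partEnt_win_eq_sum (l : ℕ) : partEnt μ (win (A := A) 0 l)
    = ∑ k ∈ Finset.range l, (partEnt μ (win (A := A) 0 (k + 1)) - partEnt μ (win (A := A) 0 k)) := by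
  have h0 : partEnt μ (win (A := A) 0 0) = 0 := by
    simp [partEnt_eq, show win (A := A) 0 0 ⁻¹' {default} = univ from
      eq_univ_of_forall fun x => Subsingleton.elim _ _]
  rw [Finset.sum_range_sub (fun k => partEnt μ (win (A := A) 0 k)), h0, sub_zero]

lemma mul_entRate_le (hσ : MeasurePreserving (shiftMap A) μ μ) (l : ℕ) :
    l * entRate μ ≤ partEnt μ (win (A := A) 0 l) := by
  rw [partEnt_win_eq_sum, ← nsmul_eq_mul]
  simpa using Finset.card_nsmul_le_sum (Finset.range l) _ _
    fun k _ => entRate_le_partEnt_win_sub μ hσ k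

lemma tendsto_partEnt_win_div (hσ : MeasurePreserving (shiftMap A) μ μ) :
    Tendsto (fun l : ℕ => partEnt μ (win (A := A) 0 l) / l) atTop (𝓝 (entRate μ)) := by
  refine ((tendsto_partEnt_win_sub μ hσ).cesaro).congr fun l => ?_
  rw [← partEnt_win_eq_sum, inv_mul_eq_div]

end WindowEntropy

/-- A cellular automaton of radius `r` on a closed shift-invariant set `X` together with a
shift-ergodic and `F`-invariant measure carried by `X`. -/
structure IsErgodicCA {A : Type*} [TopologicalSpace A] [MeasurableSpace A] (X : Set (ℤ → A))
    (F : (ℤ → A) → ℤ → A) (r : ℕ) (μ : Measure (ℤ → A)) : Prop where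
  isClosed : IsClosed X
  image_shift : shiftMap A '' X = X
  mapsTo : MapsTo F X X
  continuous : Continuous F
  comm : ∀ x, F (shiftMap A x) = shiftMap A (F x)
  dependsWithin : DependsWithin F r
  ergodic : Ergodic (shiftMap A) μ
  measurePreserving : MeasurePreserving F μ μ
  ae_mem : ∀ᵐ x ∂μ, x ∈ X

section Stopping

variable {A : Type*} {X : Set (ℤ → A)} {F : (ℤ → A) → ℤ → A} {r : ℕ}

lemma Iplus_set_iff (hFX : MapsTo F X X) {n : ℕ} {x : ℤ → A} {s : ℕ} :
    (∀ i : ℕ, 1 ≤ i → i ≤ n → F^[i] '' Wplus X (-(s : ℤ)) x ⊆ Wplus X 0 (F^[i] x)) ↔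
      ∀ y ∈ X, (∀ j, -(s : ℤ) ≤ j → y j = x j) →
        ∀ i ≤ n, ∀ j, 0 ≤ j → F^[i] y j = F^[i] x j := by
  constructor
  · intro h y hy hyx i hi j hj
    rcases Nat.eq_zero_or_pos i with rfl | h0
    · exact hyx j (by omega)
    · exact (h i h0 hi (mem_image_of_mem _ ⟨hy, hyx⟩)).2 j hj
  · rintro h i - hi _ ⟨y, ⟨hy, hyx⟩, rfl⟩
    exact ⟨hFX.iterate i hy, h y hy hyx i hi⟩

lemma Iplus_le_iff (hFX : MapsTo F X X) (hF : DependsWithin F r) {n : ℕ} {x : ℤ → A} {s : ℕ} :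
    Iplus X F n x ≤ s ↔ ∀ y ∈ X, (∀ j, -(s : ℤ) ≤ j → y j = x j) →
      ∀ i ≤ n, ∀ j, 0 ≤ j → F^[i] y j = F^[i] x j := by
  constructor
  · intro h y hy hyx
    have hne : {s : ℕ | ∀ i : ℕ, 1 ≤ i → i ≤ n →
        F^[i] '' Wplus X (-(s : ℤ)) x ⊆ Wplus X 0 (F^[i] x)}.Nonempty := by
      refine ⟨r * n, (Iplus_set_iff hFX).2 fun y _ hyx i hi j hj => ?_⟩
      refine hF.iterate i _ _ _ fun k h1 _ => hyx k ?_
      have : (r : ℤ) * i ≤ r * n := by gcongr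
      push_cast at h1 ⊢
      linarith
    exact (Iplus_set_iff hFX).1 (Nat.sInf_mem hne) y hy fun j hj => hyx j (by
      have : (Iplus X F n x : ℤ) ≤ s := by exact_mod_cast h
      exact (neg_le_neg this).trans hj)
  · exact fun h => Nat.sInf_le ((Iplus_set_iff hFX).2 h)

lemma Iplus_le (hFX : MapsTo F X X) (hF : DependsWithin F r) (n : ℕ) (x : ℤ → A) :
    Iplus X F n x ≤ r * n := by
  refine (Iplus_le_iff hFX hF).2 fun y _ hyx i hi j hj => ?_
  refine hF.iterate i _ _ _ fun k h1 _ => hyx k ?_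
  have : (r : ℤ) * i ≤ r * n := by gcongr
  push_cast at h1 ⊢
  linarith

/-- The words on `[-k, L)` that determine the space-time block over `[0, w)` within `X`. -/
def detWords (X : Set (ℤ → A)) (F : (ℤ → A) → ℤ → A) (w n k L : ℕ) : Set (Fin (L + k) → A) :=
  {v | ∀ y ∈ X, ∀ z ∈ X, win (-(k : ℤ)) (L + k) y = v → win (-(k : ℤ)) (L + k) z = v →
    col F 0 w n y = col F 0 w n z}

lemma Iplus_le_of_mem_detWords (hFX : MapsTo F X X) (hF : DependsWithin F r) {w : ℕ} (hw : r ≤ w)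
    {n k L : ℕ} {x : ℤ → A} (hx : x ∈ X)
    (h : win (-(k : ℤ)) (L + k) x ∈ detWords X F w n k L) : Iplus X F n x ≤ k := by
  refine (Iplus_le_iff hFX hF).2 fun y hy hyx => ?_
  have hcol := col_eq_iff.1 (h y hy x hx (win_eq_iff.2 fun j hj _ => hyx j hj) rfl)
  intro i
  induction i with
  | zero => exact fun _ j hj => hyx j (by omega)
  | succ i ih =>
    intro hi j hj
    by_cases hjw : j < 0 + w
    · exact hcol _ hi j hj hjw
    · rw [Function.iterate_succ_apply', Function.iterate_succ_apply']
      exact hF _ _ _ fun l hl _ => ih (by omega) l (by omega)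

lemma eventually_mem_detWords [Finite A] [TopologicalSpace A] [DiscreteTopology A]
    (hX : IsClosed X) (hFc : Continuous F) (hFX : MapsTo F X X) (hF : DependsWithin F r) {w : ℕ}
    {n k : ℕ} {x : ℤ → A} (h : Iplus X F n x ≤ k) :
    ∀ᶠ L in atTop, win (-(k : ℤ)) (L + k) x ∈ detWords X F w n k L := by
  have hwin : ∀ i m, Continuous (win (A := A) i m) := fun i m =>
    continuous_pi fun _ => continuous_apply _
  have hcol : Continuous (col F 0 w n) := continuous_pi fun t => (hwin _ _).comp (hFc.iterate t)
  obtain ⟨L₀, hL₀⟩ : ∃ L₀ : ℕ, ∀ y ∈ X, win (-(k : ℤ)) (L₀ + k) y = win (-(k : ℤ)) (L₀ + k) x →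
      col F 0 w n y = col F 0 w n x := by
    by_contra! hcon
    set K : ℕ → Set (ℤ → A) := fun L =>
      X ∩ (win (-(k : ℤ)) (L + k) ⁻¹' {win (-(k : ℤ)) (L + k) x} ∩
        col F 0 w n ⁻¹' {col F 0 w n x}ᶜ)
    have hK : ∀ L, IsClosed (K L) := fun L =>
      hX.inter (((isClosed_discrete _).preimage (hwin _ _)).inter
        ((isClosed_discrete _).preimage hcol))
    obtain ⟨y, hy⟩ := IsCompact.nonempty_iInter_of_sequence_nonempty_isCompact_isClosed K
      (fun L y hy => ⟨hy.1, win_eq_iff.2 fun j h1 h2 => win_eq_iff.1 hy.2.1 j h1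
        (by push_cast at *; omega), hy.2.2⟩)
      (fun L => by obtain ⟨y, h1, h2, h3⟩ := hcon L; exact ⟨y, h1, h2, h3⟩)
      (hK 0).isCompact hK
    rw [mem_iInter] at hy
    refine (hy 0).2.2 (col_eq_iff.2 fun t ht j h1 _ => ?_)
    refine (Iplus_le_iff hFX hF).1 h y (hy 0).1 (fun j hj => ?_) t ht j h1
    exact win_eq_iff.1 (hy (j.toNat + 1)).2.1 j hj (by push_cast; omega)
  filter_upwards [eventually_ge_atTop L₀] with L hL y hy z hz h1 h2
  have hsub : ∀ y, win (-(k : ℤ)) (L + k) y = win (-(k : ℤ)) (L + k) x →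
      win (-(k : ℤ)) (L₀ + k) y = win (-(k : ℤ)) (L₀ + k) x := fun y h =>
    win_eq_iff.2 fun j h1 h2 => win_eq_iff.1 h j h1 (by push_cast at *; omega)
  rw [hL₀ y hy (hsub y h1), hL₀ z hz (hsub z h2)]

end Stopping

section StoppingBound

set_option linter.unusedSectionVars false

variable {A : Type*} [Fintype A] [TopologicalSpace A] [DiscreteTopology A] [MeasurableSpace A]
  [MeasurableSingletonClass A] {X : Set (ℤ → A)} {F : (ℤ → A) → ℤ → A} {r : ℕ}
  {μ : Measure (ℤ → A)} [IsProbabilityMeasure μ]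

namespace IsErgodicCA

lemma measurable_comp_win {n : ℕ} (φ : (Fin n → A) → ℝ) (i : ℤ) :
    Measurable fun x : ℤ → A => φ (win i n x) :=
  (Measurable.of_discrete (f := φ)).comp (measurable_win i n)

lemma condH_col_eq_zero (hF : DependsWithin F r) (hFm : Measurable F) {w n L : ℕ}
    (hL : w + r * n ≤ L) :
    condH μ (col F 0 w n) (win (-((r * n : ℕ) : ℤ)) (L + r * n)) = 0 := by
  refine condH_eq_zero μ (measurable_col hFm _ _ _) (measurable_win _ _) fun x y hxy => ?_
  rw [win_eq_iff] at hxy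
  refine col_eq_iff.2 fun t ht k h1 h2 => hF.iterate t _ _ _ fun l h3 h4 => hxy l ?_ ?_ <;>
  · have : r * t ≤ r * n := by gcongr
    omega

/-- The words `x_{-k} ⋯ x_{L-1}` determine more and more of the space-time block as `k` grows. -/
lemma condH_col_le_sum (h : IsErgodicCA X F r μ) (w n L M : ℕ) :
    condH μ (col F 0 w n) (win 0 L) ≤ condH μ (col F 0 w n) (win (-(M : ℤ)) (L + M))
      + ∑ k ∈ Finset.range M, ∫ x, (detWords X F w n k L)ᶜ.indicator
        (condEntFn μ (fun x : ℤ → A => x (-1)) (win 0 (L + k))) (win (-(k : ℤ)) (L + k) x) ∂μ := by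
  have hσ := h.ergodic.toMeasurePreserving
  have hc := measurable_col h.measurePreserving.measurable 0 w n
  induction M with
  | zero => simp
  | succ k ih =>
    rw [Finset.sum_range_succ]
    have h1 := condH_sub_condH_le μ hc (b := fun x : ℤ → A => x (-(k : ℤ) - 1))
      (measurable_pi_apply _) (measurable_win (-(k : ℤ)) (L + k)) (detWords X F w n k L) ?_
    · have h2 : condH μ (col F 0 w n) (fun x => (x (-(k : ℤ) - 1), win (-(k : ℤ)) (L + k) x))
          = condH μ (col F 0 w n) (win (-((k + 1 : ℕ) : ℤ)) (L + (k + 1))) := by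
        refine condH_congr_right μ hc ((measurable_pi_apply _).prodMk (measurable_win _ _))
          (measurable_win _ _) fun x y => ?_
        rw [Prod.mk.injEq, win_eq_iff, win_eq_iff]
        push_cast
        refine ⟨fun h j h1 h2 => ?_, fun h => ⟨h _ (by omega) (by omega),
          fun j h1 h2 => h j (by omega) (by omega)⟩⟩
        rcases eq_or_ne j (-(k : ℤ) - 1) with rfl | hj
        · exact h.1
        · exact h.2 j (by omega) (by omega)
      have h3 : condEntFn μ (fun x : ℤ → A => x (-(k : ℤ) - 1)) (win (-(k : ℤ)) (L + k))
          = condEntFn μ (fun x : ℤ → A => x (-1)) (win 0 (L + k)) := by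
        funext v
        rw [← condEntFn_comp_measurePreserving μ (measurePreserving_shiftIter hσ (-(k : ℤ)))
          (f := fun x : ℤ → A => x (-1)) (measurable_pi_apply _) (measurable_win 0 (L + k))]
        congr 1
        · funext x; simp only [shiftIter]; congr 1; ring
        · funext x; rw [win_shiftIter, zero_add]
      rw [h2, h3] at h1
      linarith
    · intro v hv
      by_cases hne : ∃ y ∈ X, win (-(k : ℤ)) (L + k) y = v
      · obtain ⟨y, hy, hyv⟩ := hne
        refine ⟨col F 0 w n y, h.ae_mem.mono fun x hx hxv => hv x hx y hy hxv hyv⟩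
      · have : Nonempty (ℤ → A) := nonempty_of_isProbabilityMeasure μ
        exact ⟨col F 0 w n (Classical.arbitrary _),
          h.ae_mem.mono fun x hx hxv => (hne ⟨x, hx, hxv⟩).elim⟩

lemma tendsto_indicator_detWords (h : IsErgodicCA X F r μ) {w : ℕ} (hw : r ≤ w) (n k : ℕ) :
    ∀ᵐ x ∂μ, Tendsto (fun L => (detWords X F w n k L)ᶜ.indicator (fun _ => (1 : ℝ))
      (win (-(k : ℤ)) (L + k) x)) atTop (𝓝 (if k < Iplus X F n x then 1 else 0)) := by
  filter_upwards [h.ae_mem] with x hx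
  by_cases hk : k < Iplus X F n x
  · rw [if_pos hk]
    refine tendsto_const_nhds.congr fun L => ?_
    rw [indicator_of_mem]
    exact fun hm => absurd (Iplus_le_of_mem_detWords h.mapsTo h.dependsWithin hw hx hm) (by omega)
  · rw [if_neg hk]
    refine tendsto_const_nhds.congr' ?_
    filter_upwards [eventually_mem_detWords h.isClosed h.continuous h.mapsTo h.dependsWithin
      (w := w) (not_lt.1 hk)] with L hL
    rw [indicator_of_notMem (by simpa using hL)]

lemma aestronglyMeasurable_lt_Iplus (h : IsErgodicCA X F r μ) (n k : ℕ) :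
    AEStronglyMeasurable (fun x => if k < Iplus X F n x then (1 : ℝ) else 0) μ :=
  aestronglyMeasurable_of_tendsto_ae atTop (fun _ =>
    (measurable_comp_win _ _).aestronglyMeasurable)
    (h.tendsto_indicator_detWords le_rfl n k)

lemma tendsto_integral_detWords (h : IsErgodicCA X F r μ) {w : ℕ} (hw : r ≤ w) (n k : ℕ) :
    Tendsto (fun L => ∫ x, (detWords X F w n k L)ᶜ.indicator
        (condEntFn μ (fun x : ℤ → A => x (-1)) (win 0 (L + k))) (win (-(k : ℤ)) (L + k) x) ∂μ) atTop
      (𝓝 (∫ x, (if k < Iplus X F n x then 1 else 0) * futureEnt μ (shiftIter (-(k : ℤ)) x) ∂μ)) := by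
  have hσ := measurePreserving_shiftIter h.ergodic.toMeasurePreserving (-(k : ℤ))
  have h1 := hσ.quasiMeasurePreserving.ae (tendsto_condEntFn μ
    (f := fun x : ℤ → A => x (-1)) (measurable_pi_apply _) (measurable_win 0)
    (winFiltration A) fun _ => rfl)
  refine tendsto_integral_of_dominated_convergence (fun _ => (Fintype.card A : ℝ)) (fun L =>
    (measurable_comp_win _ _).aestronglyMeasurable)
    (integrable_const _) (fun L => Eventually.of_forall fun x => ?_) ?_
  · refine (norm_indicator_le_norm_self _ _).trans ?_
    rw [Real.norm_of_nonneg (condEntFn_nonneg ..)]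
    exact condEntFn_le_card ..
  · filter_upwards [h1, h.tendsto_indicator_detWords hw n k] with x hx hx'
    have := hx'.mul (hx.comp (tendsto_add_atTop_nat k))
    refine this.congr fun L => ?_
    simp only [Function.comp, win_shiftIter, zero_add]
    by_cases hm : win (-(k : ℤ)) (L + k) x ∈ (detWords X F w n k L)ᶜ <;> simp [hm]

lemma Iplus_eq_sum (hFX : MapsTo F X X) (hF : DependsWithin F r) (n : ℕ) (x : ℤ → A) :
    (Iplus X F n x : ℝ)
      = ∑ k ∈ Finset.range (r * n), if k < Iplus X F n x then (1 : ℝ) else 0 := by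
  rw [← Finset.sum_filter, Finset.sum_const, nsmul_one]
  congr 1
  rw [show (Finset.range (r * n)).filter (· < Iplus X F n x) = Finset.range (Iplus X F n x) by
    ext k; have := Iplus_le hFX hF n x; simp; omega, Finset.card_range]

lemma integrable_Iplus (h : IsErgodicCA X F r μ) (n : ℕ) : Integrable (fun x => (Iplus X F n x : ℝ)) μ := by
  refine Integrable.of_bound ?_ ((r * n : ℕ) : ℝ) (Eventually.of_forall fun x => ?_)
  · simp_rw [Iplus_eq_sum h.mapsTo h.dependsWithin]
    exact Finset.aestronglyMeasurable_fun_sum _ fun k _ => h.aestronglyMeasurable_lt_Iplus n k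
  · rw [Real.norm_of_nonneg (by positivity)]
    exact_mod_cast Iplus_le h.mapsTo h.dependsWithin n x

/-- The asymptotic conditional entropy of the space-time block given the initial condition on the
right half-line. -/
noncomputable def rightEnt (F : (ℤ → A) → ℤ → A) (μ : Measure (ℤ → A)) (w n : ℕ) : ℝ :=
  ⨅ L, condH μ (col F 0 w n) (win 0 L)

lemma rightEnt_le (hFm : Measurable F) (w n L : ℕ) :
    rightEnt F μ w n ≤ condH μ (col F 0 w n) (win 0 L) :=
  ciInf_le ⟨0, by
    rintro _ ⟨L, rfl⟩; exact condH_nonneg μ _ (measurable_col hFm _ _ _) (measurable_win _ _)⟩ L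

lemma integrable_futureEnt_shift (h : IsErgodicCA X F r μ) (k : ℕ) :
    Integrable (fun x => futureEnt μ (shiftIter (-(k : ℤ)) x)) μ := by
  have hσ := measurePreserving_shiftIter h.ergodic.toMeasurePreserving (-(k : ℤ))
  refine Integrable.of_bound ((measurable_futureEnt μ).comp hσ.measurable).aestronglyMeasurable
    (Fintype.card A : ℝ) ?_
  filter_upwards [hσ.quasiMeasurePreserving.ae (futureEnt_mem_Icc μ)] with x hx
  rw [Real.norm_of_nonneg hx.1]
  exact hx.2

lemma rightEnt_le_integral (h : IsErgodicCA X F r μ) {w : ℕ} (hw : r ≤ w) (n : ℕ) :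
    rightEnt F μ w n
      ≤ ∫ x, ∑ k ∈ Finset.range (Iplus X F n x), futureEnt μ (shiftIter (-(k : ℤ)) x) ∂μ := by
  have hFm := h.measurePreserving.measurable
  have h1 : (fun x => ∑ k ∈ Finset.range (Iplus X F n x), futureEnt μ (shiftIter (-(k : ℤ)) x))
      = fun x => ∑ k ∈ Finset.range (r * n),
        (if k < Iplus X F n x then 1 else 0) * futureEnt μ (shiftIter (-(k : ℤ)) x) := by
    funext x
    simp only [ite_mul, one_mul, zero_mul]
    rw [← Finset.sum_filter]
    congr 1
    ext k; have := Iplus_le h.mapsTo h.dependsWithin n x; simp; omega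
  rw [h1, integral_finsetSum _ fun k _ => (h.integrable_futureEnt_shift k).bdd_mul (c := 1)
    (h.aestronglyMeasurable_lt_Iplus n k) (Eventually.of_forall fun x => by
      split_ifs <;> simp)]
  refine ge_of_tendsto (tendsto_finsetSum _ fun k _ => h.tendsto_integral_detWords hw n k) ?_
  filter_upwards [eventually_ge_atTop (w + r * n)] with L hL
  refine (rightEnt_le hFm w n L).trans ((h.condH_col_le_sum w n L (r * n)).trans (le_of_eq ?_))
  rw [condH_col_eq_zero h.dependsWithin hFm hL, zero_add]

end IsErgodicCA

end StoppingBound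

section ErgodicBound

lemma exists_le_mul_add_of_tendsto_div {u : ℕ → ℝ} (hu : ∀ n, 0 ≤ u n)
    (h : Tendsto (fun n : ℕ => u n / n) atTop (𝓝 0)) {ε : ℝ} (hε : 0 < ε) :
    ∃ K, 0 ≤ K ∧ ∀ n : ℕ, u n ≤ ε * n + K := by
  obtain ⟨n₀, hn₀⟩ := eventually_atTop.1
    ((h.eventually_lt_const hε).and (eventually_gt_atTop 0))
  refine ⟨∑ k ∈ Finset.range n₀, u k, Finset.sum_nonneg fun k _ => hu k, fun n => ?_⟩
  rcases lt_or_ge n n₀ with hn | hn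
  · have := Finset.single_le_sum (f := u) (fun k _ => hu k) (Finset.mem_range.2 hn)
    have h2 : 0 ≤ ε * n := by positivity
    linarith
  · have h1 := hn₀ n hn
    have h2 : (0 : ℝ) < n := by exact_mod_cast h1.2
    have h3 : 0 ≤ ∑ k ∈ Finset.range n₀, u k := Finset.sum_nonneg fun k _ => hu k
    have := (div_lt_iff₀ h2).1 h1.1
    linarith

variable {Ω : Type*} [MeasurableSpace Ω] {μ : Measure Ω} [IsProbabilityMeasure μ]

lemma sum_range_le_of_le_mul {a : ℕ → ℝ} (ha : ∀ k, 0 ≤ a k) {c : ℝ} (hc : 0 ≤ c) {I m J : ℕ}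
    (hm : 0 < m) (hI : I < J * m) :
    ∑ k ∈ Finset.range I, a k ≤ (I + m) * c
      + ∑ i ∈ Finset.range (J + 1), |∑ k ∈ Finset.range (i * m), a k - (i * m : ℕ) * c| := by
  have hj : I / m + 1 < J + 1 := Nat.succ_lt_succ ((Nat.div_lt_iff_lt_mul hm).2 hI)
  have h1 : I ≤ (I / m + 1) * m := (Nat.lt_div_mul_add hm).le.trans_eq (by ring)
  have h2 : (((I / m + 1) * m : ℕ) : ℝ) ≤ I + m := by
    have := Nat.div_mul_le_self I m
    exact_mod_cast (by linarith : (I / m + 1) * m ≤ I + m)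
  have h3 : ∑ k ∈ Finset.range I, a k ≤ ∑ k ∈ Finset.range ((I / m + 1) * m), a k :=
    Finset.sum_le_sum_of_subset_of_nonneg (Finset.range_mono h1) fun k _ _ => ha k
  have h4 := Finset.single_le_sum
    (f := fun i => |∑ k ∈ Finset.range (i * m), a k - (i * m : ℕ) * c|)
    (fun i _ => abs_nonneg _) (Finset.mem_range.2 hj)
  have h5 := le_abs_self (∑ k ∈ Finset.range ((I / m + 1) * m), a k - ((I / m + 1) * m : ℕ) * c)
  have h6 := mul_le_mul_of_nonneg_right h2 hc
  linarith

/-- Birkhoff sums stopped at times `N ≤ R n` have mean at most `(∫ g) (∫ N) + o(n)`. -/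
lemma eventually_integral_birkhoffSum_le {T : Ω → Ω} (hT : Ergodic T μ) {g : Ω → ℝ}
    (hg : Measurable g) {C : ℝ} (hgC : ∀ᵐ x ∂μ, g x ∈ Icc 0 C) (R : ℕ) {ε : ℝ} (hε : 0 < ε) :
    ∀ᶠ n : ℕ in atTop, ∀ N : Ω → ℕ, (∀ x, N x ≤ R * n) → Integrable (fun x => (N x : ℝ)) μ →
      ∫ x, ∑ k ∈ Finset.range (N x), g (T^[k] x) ∂μ
        ≤ (∫ x, g x ∂μ) * ∫ x, (N x : ℝ) ∂μ + ε * n := by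
  have hTm := hT.toMeasurePreserving
  set c := ∫ x, g x ∂μ with hc
  have hc0 : 0 ≤ c := integral_nonneg_of_ae (hgC.mono fun x hx => hx.1)
  have hmem : MemLp g 2 μ := MemLp.of_bound hg.aestronglyMeasurable C (hgC.mono fun x hx => by
    rw [Real.norm_of_nonneg hx.1]; exact hx.2)
  have hall : ∀ᵐ x ∂μ, ∀ k, 0 ≤ g (T^[k] x) := ae_all_iff.2 fun k =>
    (hTm.iterate k).quasiMeasurePreserving.ae (hgC.mono fun x hx => hx.1)
  have hgi : ∀ n, Integrable (fun x => |∑ k ∈ Finset.range n, g (T^[k] x) - n * c|) μ := fun n =>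
    ((integrable_finsetSum _ fun k _ => (hmem.comp_measurePreserving (hTm.iterate k)).integrable
      (by norm_num)).sub (integrable_const _)).abs
  set E : ℕ → ℝ := fun n => ∫ x, |∑ k ∈ Finset.range n, g (T^[k] x) - n * c| ∂μ with hE
  obtain ⟨J, hJ⟩ := exists_nat_gt (c * R / (ε / 4))
  have hJ0 : (0 : ℝ) < J := lt_of_le_of_lt (by positivity) hJ
  have hJR : c * R / J ≤ ε / 4 := by
    rw [div_lt_iff₀ (by positivity)] at hJ
    rw [div_le_iff₀ hJ0]
    linarith
  obtain ⟨K, hK0, hK⟩ := exists_le_mul_add_of_tendsto_div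
    (fun n => integral_nonneg fun x => abs_nonneg _)
    (tendsto_integral_abs_birkhoffSum μ hT hmem)
    (ε := ε / (4 * ((J + 1) * (J * (R + 1))))) (by positivity)
  obtain ⟨n₀, hn₀⟩ := exists_nat_gt ((c + (J + 1) * K) / (ε / 4))
  filter_upwards [eventually_ge_atTop n₀, eventually_gt_atTop 0] with n hn hn1 N hN hNi
  have hn' : c + (J + 1) * K ≤ ε / 4 * n := by
    rw [div_lt_iff₀ (by positivity)] at hn₀
    have : (n₀ : ℝ) ≤ n := by exact_mod_cast hn
    nlinarith
  set m := R * n / J + 1 with hm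
  have hmJ : R * n < J * m := Nat.lt_mul_div_succ _ (by exact_mod_cast hJ0)
  have hmle : (m : ℝ) ≤ R * n / J + 1 := by
    rw [hm]; push_cast
    have := Nat.cast_div_le (α := ℝ) (m := R * n) (n := J)
    push_cast at this
    linarith
  have hmle' : m ≤ (R + 1) * n := by
    have := Nat.div_le_self (R * n) J
    linarith
  have hEm : ∀ i ∈ Finset.range (J + 1), E (i * m) ≤ ε / (4 * (J + 1)) * n + K := by
    intro i hi
    refine (hK (i * m)).trans ?_
    have : ((i * m : ℕ) : ℝ) ≤ J * ((R + 1) * n) := by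
      exact_mod_cast Nat.mul_le_mul (by simpa [Nat.lt_succ_iff] using hi) hmle'
    calc _ ≤ ε / (4 * ((J + 1) * (J * (R + 1)))) * (J * ((R + 1) * n)) + K := by gcongr
      _ = _ := by field_simp
  have hNm : Integrable (fun x => (N x : ℝ) + m) μ := hNi.add (integrable_const _)
  calc ∫ x, ∑ k ∈ Finset.range (N x), g (T^[k] x) ∂μ
      ≤ ∫ x, ((N x + m) * c + ∑ i ∈ Finset.range (J + 1),
          |∑ k ∈ Finset.range (i * m), g (T^[k] x) - (i * m : ℕ) * c|) ∂μ := by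
        refine integral_mono_of_nonneg (hall.mono fun x hx => Finset.sum_nonneg fun k _ => hx k)
          ((hNm.mul_const _).add
            (integrable_finsetSum _ fun i _ => hgi _)) (hall.mono fun x hx => ?_)
        exact sum_range_le_of_le_mul hx hc0 (Nat.succ_pos _) ((hN x).trans_lt hmJ)
    _ = (∫ x, (N x : ℝ) ∂μ + m) * c + ∑ i ∈ Finset.range (J + 1), E (i * m) := by
        rw [integral_add (hNm.mul_const _)
            (integrable_finsetSum _ fun i _ => hgi _), integral_mul_const,
          integral_add hNi (integrable_const _), integral_finsetSum _ fun i _ => hgi _]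
        simp [hE]
    _ ≤ (∫ x, (N x : ℝ) ∂μ + (R * n / J + 1)) * c
          + ∑ i ∈ Finset.range (J + 1), (ε / (4 * (J + 1)) * n + K) := by
        gcongr with i hi
        exact hEm i hi
    _ = c * ∫ x, (N x : ℝ) ∂μ + (c * R / J * n + ε / 4 * n + (c + (J + 1) * K)) := by
        rw [Finset.sum_const, Finset.card_range, nsmul_eq_mul]
        push_cast
        field_simp
        ring
    _ ≤ c * ∫ x, (N x : ℝ) ∂μ + ε * n := by
        have : c * R / J * n ≤ ε / 4 * n := by gcongr
        have : 0 ≤ ε * n := by positivity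
        linarith

end ErgodicBound

section RightEntropy

set_option linter.unusedSectionVars false

variable {A : Type*} [Fintype A] [TopologicalSpace A] [DiscreteTopology A] [MeasurableSpace A]
  [MeasurableSingletonClass A] {X : Set (ℤ → A)} {F : (ℤ → A) → ℤ → A} {r : ℕ}
  {μ : Measure (ℤ → A)} [IsProbabilityMeasure μ]

lemma ergodic_shiftIter_neg_one (h : Ergodic (shiftMap A) μ) : Ergodic (shiftIter (A := A) (-1)) μ :=
  Ergodic.symm (e := shiftEquiv A 1) h

lemma exists_partEnt_win_le (hσ : MeasurePreserving (shiftMap A) μ μ) {ε : ℝ} (hε : 0 < ε) :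
    ∃ K, ∀ l : ℕ, partEnt μ (win (A := A) 0 l) ≤ l * entRate μ + ε * l + K := by
  obtain ⟨K, -, hK⟩ := exists_le_mul_add_of_tendsto_div
    (u := fun l => partEnt μ (win (A := A) 0 l) - l * entRate μ)
    (fun l => sub_nonneg.2 (mul_entRate_le μ hσ l)) (by
      have h := (tendsto_partEnt_win_div μ hσ).sub_const (entRate μ)
      rw [sub_self] at h
      refine h.congr' ?_
      filter_upwards [eventually_ne_atTop 0] with l hl
      have : (l : ℝ) ≠ 0 := by exact_mod_cast hl
      field_simp) hε
  exact ⟨K, fun l => by linarith [hK l]⟩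

lemma mul_entRate_le_sub (hσ : MeasurePreserving (shiftMap A) μ μ) (l m : ℕ) :
    m * entRate μ ≤ partEnt μ (win (A := A) 0 (l + m)) - partEnt μ (win (A := A) 0 l) := by
  induction m with
  | zero => simp
  | succ m ih =>
    have := entRate_le_partEnt_win_sub μ hσ (l + m)
    push_cast
    rw [← add_assoc]
    linarith

lemma condH_win_neg (hσ : MeasurePreserving (shiftMap A) μ μ) {L L' : ℕ} (hL : L ≤ L') (M : ℕ) :
    condH μ (win (A := A) (-(M : ℤ)) (L + M)) (win 0 L')
      = partEnt μ (win (A := A) 0 (L' + M)) - partEnt μ (win (A := A) 0 L') := by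
  rw [condH, ← partEnt_win μ hσ (-(M : ℤ)) (L' + M)]
  congr 1
  refine partEnt_eq_of_factor μ ((measurable_win _ _).prodMk (measurable_win _ _))
    (measurable_win _ _) fun x y => ?_
  rw [Prod.mk.injEq, win_eq_iff, win_eq_iff, win_eq_iff]
  push_cast
  refine ⟨fun h => ⟨fun k h1 h2 => h k (by omega) (by omega),
    fun k h1 h2 => h k (by omega) (by omega)⟩, fun h k h1 h2 => ?_⟩
  rcases lt_or_ge k 0 with hk | hk
  · exact h.1 k h1 (by omega)
  · exact h.2 k hk (by omega)

lemma condH_sub_le_of_factor {Ω I J K K' : Type*} [MeasurableSpace Ω] {ν : Measure Ω}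
    [IsProbabilityMeasure ν] [Fintype I] [MeasurableSpace I] [MeasurableSingletonClass I]
    [Fintype J] [MeasurableSpace J] [MeasurableSingletonClass J]
    [Fintype K] [MeasurableSpace K] [MeasurableSingletonClass K]
    [Fintype K'] [MeasurableSpace K'] [MeasurableSingletonClass K']
    {c : Ω → I} {u : Ω → J} {v : Ω → K} {v' : Ω → K'} (hc : Measurable c) (hu : Measurable u)
    (hv : Measurable v) (hv' : Measurable v') (hcu : ∀ x y, u x = u y → c x = c y)
    (hvv : ∀ x y, v' x = v' y → v x = v y) :
    condH ν c v - condH ν c v' ≤ condH ν u v - condH ν u v' := by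
  have e1 : condH ν u v = condH ν (fun x => (c x, u x)) v :=
    condH_congr_left ν hu (hc.prodMk hu) hv fun x y => by
      simp only [Prod.mk.injEq]; have := hcu x y; tauto
  have e2 : condH ν u v' = condH ν (fun x => (c x, u x)) v' :=
    condH_congr_left ν hu (hc.prodMk hu) hv' fun x y => by
      simp only [Prod.mk.injEq]; have := hcu x y; tauto
  rw [e1, e2, condH_prod ν hc hu hv, condH_prod ν hc hu hv']
  have := condH_le_of_factor ν hu (hc.prodMk hv') (hc.prodMk hv) fun x y => by
    simp only [Prod.mk.injEq]; have := hvv x y; tauto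
  linarith

namespace IsErgodicCA

lemma condH_col_antitone (h : IsErgodicCA X F r μ) (w n : ℕ) :
    Antitone fun L => condH μ (col F 0 w n) (win 0 L) := fun L L' hL =>
  condH_le_of_factor μ (measurable_col h.measurePreserving.measurable _ _ _) (measurable_win _ _)
    (measurable_win _ _) fun x y hxy => by
      rw [win_eq_iff] at hxy ⊢
      exact fun k h1 h2 => hxy k h1 (by omega)

lemma condH_col_le_rightEnt (h : IsErgodicCA X F r μ) {w n L : ℕ} (hL : w + r * n ≤ L) :
    condH μ (col F 0 w n) (win 0 L) ≤ rightEnt F μ w n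
      + (partEnt μ (win (A := A) 0 (L + r * n)) - partEnt μ (win (A := A) 0 L)
        - (r * n : ℕ) * entRate μ) := by
  have hσ := h.ergodic.toMeasurePreserving
  have hc := measurable_col h.measurePreserving.measurable 0 w n
  rw [← sub_le_iff_le_add]
  refine le_ciInf fun L' => ?_
  rcases le_total L L' with hLL | hLL
  · have h1 := condH_sub_le_of_factor (ν := μ) hc
      (measurable_win (-((r * n : ℕ) : ℤ)) (L + r * n)) (measurable_win 0 L) (measurable_win 0 L')
      (fun x y hxy => ?_) fun x y hxy => ?_
    · rw [condH_win_neg hσ le_rfl, condH_win_neg hσ hLL] at h1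
      have h2 := mul_entRate_le_sub hσ L' (r * n)
      linarith
    · rw [win_eq_iff] at hxy
      refine col_eq_iff.2 fun t ht k h1 h2 => h.dependsWithin.iterate t _ _ _ fun l h3 h4 =>
        hxy l ?_ ?_ <;>
      · have : r * t ≤ r * n := by gcongr
        omega
    · rw [win_eq_iff] at hxy ⊢
      exact fun k h1 h2 => hxy k h1 (by omega)
  · have h1 := h.condH_col_antitone w n hLL
    have h2 := mul_entRate_le_sub hσ L (r * n)
    simp only at h1
    linarith

lemma condH_col_add_le (h : IsErgodicCA X F r μ) {w : ℕ} (hw : r ≤ w) (m n L : ℕ) :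
    condH μ (col F 0 w (m + n)) (win 0 (L + r * m))
      ≤ condH μ (col F 0 w m) (win 0 (L + r * m)) + condH μ (col F 0 w n) (win 0 L) := by
  have hFm := h.measurePreserving.measurable
  have hc := measurable_col hFm 0 w
  have hFi := h.measurePreserving.iterate m
  have h1 : condH μ (col F 0 w (m + n)) (win 0 (L + r * m))
      ≤ condH μ (fun x => (col F 0 w m x, col F 0 w n (F^[m] x))) (win 0 (L + r * m)) := by
    refine condH_mono_left μ ((hc m).prodMk ((hc n).comp hFi.measurable)) (measurable_win _ _)
      fun x y hxy => ?_
    rw [Prod.mk.injEq, col_eq_iff, col_eq_iff] at hxy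
    refine col_eq_iff.2 fun t ht => ?_
    rcases le_total t m with htm | htm
    · exact hxy.1 t htm
    · have := hxy.2 (t - m) (by omega)
      simpa only [← Function.iterate_add_apply, Nat.sub_add_cancel htm] using this
  have h2 := condH_le_of_factor μ (f := fun x => col F 0 w n (F^[m] x))
    (g := fun x => (col F 0 w m x, win 0 (L + r * m) x)) (h := fun x => win 0 L (F^[m] x))
    ((hc n).comp hFi.measurable) ((hc m).prodMk (measurable_win _ _))
    ((measurable_win _ _).comp hFi.measurable) fun x y hxy => by
      rw [Prod.mk.injEq, col_eq_iff, win_eq_iff] at hxy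
      obtain ⟨hxy1, hxy2⟩ := hxy
      have key : ∀ i j, i + j = m → ∀ k : ℤ, 0 ≤ k → k < L + r * j → F^[i] x k = F^[i] y k := by
        intro i
        induction i with
        | zero =>
          intro j hj k hk1 hk2
          obtain rfl : j = m := by omega
          exact hxy2 k hk1 (by push_cast; omega)
        | succ i ih =>
          intro j hj k h1 h2
          rcases lt_or_ge k w with hkw | hkw
          · exact hxy1 (i + 1) (by omega) k h1 (by omega)
          · rw [Function.iterate_succ_apply', Function.iterate_succ_apply']
            refine h.dependsWithin _ _ _ fun l h3 h4 => ih (j + 1) (by omega) l (by omega) ?_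
            push_cast
            linarith
      exact win_eq_iff.2 fun k h1 h2 => key m 0 rfl k h1 (by simpa using h2)
  rw [condH_comp_measurePreserving μ hFi (hc n) (measurable_win 0 L)] at h2
  rw [condH_prod μ (g := fun x => col F 0 w n (F^[m] x)) (hc m) ((hc n).comp hFi.measurable)
    (measurable_win _ _)] at h1
  exact h1.trans (add_le_add_right h2 _)

lemma subadditive_rightEnt (h : IsErgodicCA X F r μ) {w : ℕ} (hw : r ≤ w) :
    Subadditive (rightEnt F μ w) := fun m n => by
  refine le_ciInf_add_ciInf fun L₁ L₂ => ?_
  refine (rightEnt_le h.measurePreserving.measurable w _ (max L₁ L₂ + r * m)).trans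
    ((h.condH_col_add_le hw m n _).trans (add_le_add ?_ ?_))
  · exact h.condH_col_antitone w m (by omega)
  · exact h.condH_col_antitone w n (by omega)

lemma rightEnt_nonneg (h : IsErgodicCA X F r μ) (w n : ℕ) : 0 ≤ rightEnt F μ w n :=
  le_ciInf fun _ => condH_nonneg μ _ (measurable_col h.measurePreserving.measurable _ _ _)
    (measurable_win _ _)

lemma eventually_rightEnt_le_integral (h : IsErgodicCA X F r μ) {w : ℕ} (hw : r ≤ w) {ε : ℝ}
    (hε : 0 < ε) :
    ∀ᶠ n : ℕ in atTop, rightEnt F μ w n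
      ≤ entRate μ * ∫ x, (Iplus X F n x : ℝ) ∂μ + ε * n := by
  filter_upwards [eventually_integral_birkhoffSum_le (ergodic_shiftIter_neg_one h.ergodic)
    (measurable_futureEnt μ) (futureEnt_mem_Icc μ) r hε] with n hn
  refine (h.rightEnt_le_integral hw n).trans (le_trans (le_of_eq ?_)
    (hn (Iplus X F n) (Iplus_le h.mapsTo h.dependsWithin n) (h.integrable_Iplus n)))
  simp only [iterate_shiftIter, mul_neg_one]

lemma integral_Iplus_div_mem_Icc (h : IsErgodicCA X F r μ) (n : ℕ) :
    (∫ x, (Iplus X F n x : ℝ) ∂μ) / n ∈ Icc (0 : ℝ) r := by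
  refine ⟨div_nonneg (integral_nonneg fun x => by positivity) (by positivity),
    div_le_of_le_mul₀ (by positivity) (by positivity) ?_⟩
  have := integral_mono (μ := μ) (h.integrable_Iplus n) (integrable_const ((r * n : ℕ) : ℝ))
    fun x => Nat.cast_le.2 (Iplus_le h.mapsTo h.dependsWithin n x)
  simpa using this

lemma isBoundedUnder_integral_Iplus_div (h : IsErgodicCA X F r μ) :
    IsBoundedUnder (· ≤ ·) atTop fun n : ℕ => (∫ x, (Iplus X F n x : ℝ) ∂μ) / n :=
  isBoundedUnder_of ⟨r, fun n => (h.integral_Iplus_div_mem_Icc n).2⟩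

lemma avgIplus_nonneg (h : IsErgodicCA X F r μ) : 0 ≤ avgIplus X F μ :=
  le_liminf_of_le (h.isBoundedUnder_integral_Iplus_div.isCoboundedUnder_ge)
    (Eventually.of_forall fun n => (h.integral_Iplus_div_mem_Icc n).1)

lemma eventually_rightEnt_le (h : IsErgodicCA X F r μ) {w : ℕ} (hw : r ≤ w) {ε : ℝ}
    (hε : 0 < ε) :
    ∀ᶠ n : ℕ in atTop, rightEnt F μ w n ≤ (entRate μ * avgIplus X F μ + ε) * n := by
  have hsub := h.subadditive_rightEnt hw
  have hbdd : BddBelow (range fun n : ℕ => rightEnt F μ w n / n) :=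
    ⟨0, by rintro _ ⟨n, rfl⟩; exact div_nonneg (h.rightEnt_nonneg w n) (by positivity)⟩
  have hE := entRate_nonneg μ
  have hlim : ∀ δ > 0, hsub.lim ≤ entRate μ * (avgIplus X F μ + δ) + δ := by
    intro δ hδ
    have h1 := frequently_lt_of_liminf_lt (b := avgIplus X F μ + δ) (f := atTop)
      (u := fun n : ℕ => (∫ x, (Iplus X F n x : ℝ) ∂μ) / n)
      (h.isBoundedUnder_integral_Iplus_div.isCoboundedUnder_ge) (lt_add_of_pos_right _ hδ)
    obtain ⟨n, hn1, hn2, hn3⟩ := (h1.and_eventually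
      ((h.eventually_rightEnt_le_integral hw hδ).and (eventually_gt_atTop 0))).exists
    have hn : (0 : ℝ) < n := by exact_mod_cast hn3
    refine (hsub.lim_le_div hbdd hn3.ne').trans ?_
    rw [div_le_iff₀ hn]
    rw [div_lt_iff₀ hn] at hn1
    nlinarith [mul_le_mul_of_nonneg_left hn1.le hE]
  have hlim' : hsub.lim ≤ entRate μ * avgIplus X F μ := by
    refine le_of_forall_pos_le_add fun ε hε => ?_
    refine (hlim (ε / (entRate μ + 1)) (by positivity)).trans (le_of_eq ?_)
    field_simp
    ring
  filter_upwards [(hsub.tendsto_lim hbdd).eventually_lt_const (hlim'.trans_lt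
    (lt_add_of_pos_right _ hε)), eventually_gt_atTop 0] with n hn hn0
  exact ((div_lt_iff₀ (by exact_mod_cast hn0)).1 hn).le

/-- The entropy of the space-time block given a long enough word to its right. -/
lemma eventually_condH_col_le (h : IsErgodicCA X F r μ) {w : ℕ} (hw : r ≤ w) {ε : ℝ}
    (hε : 0 < ε) :
    ∀ᶠ n : ℕ in atTop, condH μ (col F 0 w n) (win 0 (w + r * n))
      ≤ (entRate μ * avgIplus X F μ + ε) * n := by
  have hσ := h.ergodic.toMeasurePreserving
  obtain ⟨K, hK⟩ := exists_partEnt_win_le hσ (ε := ε / (4 * (2 * r + 1))) (by positivity)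
  obtain ⟨n₀, hn₀⟩ := exists_nat_gt ((ε / (4 * (2 * r + 1)) * w + K) / (ε / 4))
  filter_upwards [h.eventually_rightEnt_le hw (half_pos hε), eventually_ge_atTop n₀]
    with n hn hn0
  have h1 := h.condH_col_le_rightEnt (w := w) (n := n) le_rfl
  have h2 := hK (w + r * n + r * n)
  have h3 := mul_entRate_le μ hσ (w + r * n)
  have h4 : ε / (4 * (2 * r + 1)) * w + K ≤ ε / 4 * n := by
    rw [div_lt_iff₀ (by positivity)] at hn₀
    have : (n₀ : ℝ) ≤ n := by exact_mod_cast hn0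
    nlinarith
  have h5 : ε / (4 * (2 * r + 1)) * (2 * r * n) ≤ ε / 4 * n := by
    calc ε / (4 * (2 * r + 1)) * (2 * r * n) ≤ ε / (4 * (2 * r + 1)) * ((2 * r + 1) * n) := by
          gcongr; linarith
      _ = ε / 4 * n := by field_simp
  push_cast at *
  linarith

end IsErgodicCA

end RightEntropy

section Reflection

variable {A : Type*}

/-- The reflection `x ↦ (x_{-i})_i`. -/
def reflect (x : ℤ → A) : ℤ → A := fun i => x (-i)

lemma reflect_reflect (x : ℤ → A) : reflect (reflect x) = x := by
  funext i; simp [reflect]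

lemma reflect_injective : Function.Injective (reflect (A := A)) :=
  Function.LeftInverse.injective reflect_reflect

lemma reflect_shiftIter (j : ℤ) (x : ℤ → A) :
    reflect (shiftIter j x) = shiftIter (-j) (reflect x) := by
  funext i; simp only [reflect, shiftIter]; congr 1; ring

/-- The reflection as a measurable equivalence. -/
def reflectEquiv (A : Type*) [MeasurableSpace A] : (ℤ → A) ≃ᵐ (ℤ → A) where
  toFun := reflect
  invFun := reflect
  left_inv := reflect_reflect
  right_inv := reflect_reflect
  measurable_toFun := measurable_pi_lambda _ fun _ => measurable_pi_apply _
  measurable_invFun := measurable_pi_lambda _ fun _ => measurable_pi_apply _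

/-- The cellular automaton conjugate to `F` by the reflection. -/
def reflectCA (F : (ℤ → A) → ℤ → A) (x : ℤ → A) : ℤ → A := reflect (F (reflect x))

lemma iterate_reflectCA (F : (ℤ → A) → ℤ → A) (n : ℕ) (x : ℤ → A) :
    (reflectCA F)^[n] (reflect x) = reflect (F^[n] x) := by
  refine (Function.Semiconj.iterate_right (f := reflect) (ga := F) (gb := reflectCA F)
    (fun y => ?_) n x).symm
  rw [reflectCA, reflect_reflect]

lemma Wplus_reflect (X : Set (ℤ → A)) (s : ℤ) (x : ℤ → A) :
    Wplus (reflect ⁻¹' X) (-s) (reflect x) = reflect '' Wminus X s x := by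
  ext y
  simp only [Wplus, mem_ofPred_eq, mem_preimage, mem_image, Wminus]
  constructor
  · exact fun ⟨h1, h2⟩ => ⟨reflect y, ⟨h1, fun i hi => by
      simpa [reflect] using h2 (-i) (by omega)⟩, reflect_reflect y⟩
  · rintro ⟨z, ⟨h1, h2⟩, rfl⟩
    exact ⟨by rwa [reflect_reflect], fun i hi => h2 (-i) (by omega)⟩

lemma Iplus_reflect (X : Set (ℤ → A)) (F : (ℤ → A) → ℤ → A) (n : ℕ) (x : ℤ → A) :
    Iplus (reflect ⁻¹' X) (reflectCA F) n (reflect x) = Iminus X F n x := by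
  unfold Iplus Iminus
  congr 1
  ext s
  refine forall_congr' fun i => forall_congr' fun _ => forall_congr' fun _ => ?_
  rw [iterate_reflectCA, Wplus_reflect, ← neg_zero (G := ℤ), Wplus_reflect, neg_zero, image_image]
  simp only [iterate_reflectCA]
  rw [← image_image, image_subset_image_iff reflect_injective]

variable [Fintype A] [TopologicalSpace A] [DiscreteTopology A] [MeasurableSpace A]
  [MeasurableSingletonClass A] {X : Set (ℤ → A)} {F : (ℤ → A) → ℤ → A} {r : ℕ}
  {μ : Measure (ℤ → A)} [IsProbabilityMeasure μ]

set_option linter.unusedSectionVars false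

lemma measurePreserving_reflect : MeasurePreserving reflect μ (μ.map reflect) :=
  (reflectEquiv A).measurable.measurePreserving μ

instance isProbabilityMeasure_map_reflect : IsProbabilityMeasure (μ.map reflect) :=
  Measure.isProbabilityMeasure_map (reflectEquiv A).measurable.aemeasurable

lemma continuous_reflect : Continuous (reflect (A := A)) :=
  continuous_pi fun _ => continuous_apply _

lemma ergodic_map_reflect (h : Ergodic (shiftMap A) μ) :
    Ergodic (shiftMap A) (μ.map reflect) := by
  have h1 := ((measurePreserving_reflect (μ := μ)).ergodic_conjugate_iff
    (e := reflectEquiv A)).2 (ergodic_shiftIter_neg_one h)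
  convert h1 using 1
  funext x
  change _ = reflect (shiftIter (-1) (reflect x))
  rw [reflect_shiftIter, reflect_reflect]
  rfl

lemma IsErgodicCA.reflect (h : IsErgodicCA X F r μ) :
    IsErgodicCA (reflect ⁻¹' X) (reflectCA F) r (μ.map reflect) where
  isClosed := h.isClosed.preimage continuous_reflect
  image_shift := by
    have hX : ∀ j, MapsTo (shiftIter j) (_root_.reflect ⁻¹' X) (_root_.reflect ⁻¹' X) :=
      fun j x hx => by
        rw [mem_preimage, reflect_shiftIter]
        exact mapsTo_shiftIter h.image_shift _ hx
    rw [← shiftIter_one]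
    refine (hX 1).image_subset.antisymm fun x hx => ⟨shiftIter (-1) x, hX _ hx, ?_⟩
    rw [shiftIter_shiftIter, add_neg_cancel, shiftIter_zero]
  mapsTo x hx := by
    rw [mem_preimage, reflectCA, reflect_reflect]
    exact h.mapsTo hx
  continuous := continuous_reflect.comp (h.continuous.comp continuous_reflect)
  comm x := by
    rw [← shiftIter_one, reflectCA, reflect_shiftIter, commute_shiftIter h.comm, reflect_shiftIter,
      neg_neg, reflectCA]
  dependsWithin x y i hxy := h.dependsWithin _ _ _ fun k h1 h2 => hxy _ (by omega) (by omega)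
  ergodic := ergodic_map_reflect h.ergodic
  measurePreserving := by
    have h1 : MeasurePreserving (_root_.reflect (A := A)) (μ.map _root_.reflect) μ :=
      MeasurePreserving.symm (reflectEquiv A) measurePreserving_reflect
    exact measurePreserving_reflect.comp (h.measurePreserving.comp h1)
  ae_mem := by
    refine (reflectEquiv A).measurableEmbedding.ae_map_iff.2 ?_
    filter_upwards [h.ae_mem] with x hx
    change _root_.reflect (_root_.reflect x) ∈ X
    rwa [reflect_reflect]

lemma avgIplus_reflect :
    avgIplus (reflect ⁻¹' X) (reflectCA F) (μ.map reflect) = avgIminus X F μ := by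
  unfold avgIplus avgIminus
  congr 1
  funext n
  congr 1
  have := integral_map_equiv (μ := μ) (reflectEquiv A)
    fun x => (Iplus (reflect ⁻¹' X) (reflectCA F) n x : ℝ)
  refine this.trans (integral_congr_ae (Eventually.of_forall fun x => ?_))
  exact congrArg _ (Iplus_reflect X F n x)

lemma entRate_reflect (h : Ergodic (shiftMap A) μ) : entRate (μ.map reflect) = entRate μ := by
  have h1 := tendsto_partEnt_win_div (μ.map reflect) (ergodic_map_reflect h).toMeasurePreserving
  refine tendsto_nhds_unique h1 ((tendsto_partEnt_win_div μ h.toMeasurePreserving).congr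
    fun l => ?_)
  rw [← partEnt_comp_measurePreserving μ measurePreserving_reflect (measurable_win 0 l),
    ← partEnt_win μ h.toMeasurePreserving (1 - l)]
  congr 1
  refine partEnt_eq_of_factor μ (measurable_win _ _)
    ((measurable_win _ _).comp (reflectEquiv A).measurable) fun x y => ?_
  rw [win_eq_iff, win_eq_iff]
  refine ⟨fun h k h1 h2 => ?_, fun h k h1 h2 => h (-k) (by omega) (by omega)⟩
  simpa [reflect] using h (-k) (by omega) (by omega)

namespace IsErgodicCA

lemma avgIminus_nonneg (h : IsErgodicCA X F r μ) : 0 ≤ avgIminus X F μ := by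
  rw [← avgIplus_reflect]
  exact h.reflect.avgIplus_nonneg

/-- The entropy of the space-time block given a long enough word to its left. -/
lemma eventually_condH_col_left_le (h : IsErgodicCA X F r μ) {w : ℕ} (hw : r ≤ w) {ε : ℝ}
    (hε : 0 < ε) :
    ∀ᶠ n : ℕ in atTop, condH μ (col F 0 w n) (win (-((r * n : ℕ) : ℤ)) (w + r * n))
      ≤ (entRate μ * avgIminus X F μ + ε) * n := by
  have hFm := h.measurePreserving.measurable
  have hT : MeasurePreserving (fun x => _root_.reflect (shiftIter (w - 1) x)) μ
      (μ.map (_root_.reflect (A := A))) := measurePreserving_reflect.comp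
    (measurePreserving_shiftIter h.ergodic.toMeasurePreserving (w - 1))
  have key := h.reflect.eventually_condH_col_le hw hε
  rw [entRate_reflect h.ergodic, avgIplus_reflect] at key
  filter_upwards [key] with n hn
  refine le_trans (le_of_eq ?_) hn
  have hcol : Measurable (col (reflectCA F) 0 w n) :=
    measurable_col h.reflect.measurePreserving.measurable 0 w n
  have hwin := measurable_win (A := A) 0 (w + r * n)
  rw [← condH_comp_measurePreserving μ hT hcol hwin]
  have hit : ∀ (t : ℕ) (x : ℤ → A) (k : ℤ),
      (reflectCA F)^[t] (_root_.reflect (shiftIter (w - 1) x)) k = F^[t] x (w - 1 - k) := by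
    intro t x k
    rw [iterate_reflectCA, iterate_commute_shiftIter h.comm]
    exact congrArg (F^[t] x) (by ring)
  refine (condH_congr_left μ (measurable_col hFm 0 w n) (hcol.comp hT.measurable)
    (measurable_win _ _) fun x y => ?_).trans (condH_congr_right μ (hcol.comp hT.measurable)
    (measurable_win _ _) (hwin.comp hT.measurable) fun x y => ?_)
  · rw [Function.comp_apply, Function.comp_apply, col_eq_iff, col_eq_iff]
    simp only [hit]
    refine forall₂_congr fun t _ => ⟨fun h k h1 h2 => h _ (by omega) (by omega),
      fun h k h1 h2 => ?_⟩
    simpa using h (w - 1 - k) (by omega) (by omega)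
  · have h0 := hit 0
    simp only [Function.iterate_zero, id_eq] at h0
    rw [win_eq_iff, win_eq_iff]
    simp only [h0]
    refine ⟨fun h k h1 h2 => h _ (by omega) (by omega), fun h k h1 h2 => ?_⟩
    simpa using h (w - 1 - k) (by omega) (by omega)

end IsErgodicCA

end Reflection

lemma le_of_eventually_mul_le {a b C : ℝ} (h : ∀ᶠ n : ℕ in atTop, a * n ≤ b * n + C) : a ≤ b := by
  by_contra! hab
  obtain ⟨N, hN⟩ := exists_nat_gt (C / (a - b))
  obtain ⟨n, hn, hNn⟩ := (h.and (eventually_ge_atTop N)).exists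
  rw [div_lt_iff₀ (sub_pos.2 hab)] at hN
  have : (N : ℝ) * (a - b) ≤ n * (a - b) :=
    mul_le_mul_of_nonneg_right (by exact_mod_cast hNn) (sub_pos.2 hab).le
  linarith

section Partitions

variable {Ω : Type*} [MeasurableSpace Ω] (μ : Measure Ω) [IsProbabilityMeasure μ]
  {I J : Type*} [Fintype I] [MeasurableSpace I] [MeasurableSingletonClass I]
  [Fintype J] [MeasurableSpace J] [MeasurableSingletonClass J]

lemma condH_pi_le {m : ℕ} {f : Fin m → Ω → I} {g : Ω → J} (hf : ∀ t, Measurable (f t))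
    (hg : Measurable g) : condH μ (fun x t => f t x) g ≤ ∑ t, condH μ (f t) g := by
  induction m with
  | zero =>
    rw [condH_eq_zero μ (measurable_pi_lambda _ hf) hg fun x y _ => Subsingleton.elim _ _]
    simp
  | succ m ih =>
    have hm : Measurable fun x (t : Fin m) => f t.succ x := measurable_pi_lambda _ fun t => hf _
    rw [condH_congr_left μ (measurable_pi_lambda _ hf) ((hf 0).prodMk hm) hg fun x y => by
      simp only [Prod.mk.injEq, funext_iff, Fin.forall_fin_succ], condH_prod μ (hf 0) hm hg,
      Fin.sum_univ_succ]
    gcongr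
    exact (condH_le_of_factor μ hm ((hf 0).prodMk hg) hg fun x y h => (Prod.mk.inj h).2).trans
      (ih fun t => hf t.succ)

lemma partEnt_iterate_le {T : Ω → Ω} (hT : MeasurePreserving T μ μ) {β : Ω → I} {γ : Ω → J}
    (hβ : Measurable β) (hγ : Measurable γ) (n : ℕ) :
    partEnt μ (fun x (t : Fin n) => β (T^[t] x))
      ≤ partEnt μ (fun x (t : Fin n) => γ (T^[t] x)) + n * condH μ β γ := by
  have hB : ∀ t : Fin n, Measurable fun x => β (T^[t] x) :=
    fun t => hβ.comp (hT.measurable.iterate t)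
  have hC : ∀ t : Fin n, Measurable fun x => γ (T^[t] x) :=
    fun t => hγ.comp (hT.measurable.iterate t)
  have hCm := measurable_pi_lambda _ hC
  have h1 := partEnt_le_of_factor μ (f := fun x (t : Fin n) => β (T^[t] x))
    ((measurable_pi_lambda _ hB).prodMk hCm) fun x y h => (Prod.mk.inj h).1
  have h2 : condH μ (fun x (t : Fin n) => β (T^[t] x)) (fun x (t : Fin n) => γ (T^[t] x))
      ≤ n * condH μ β γ := by
    refine (condH_pi_le μ hB hCm).trans ?_
    rw [← nsmul_eq_mul]
    refine (Finset.sum_le_card_nsmul _ _ (condH μ β γ) fun t _ => ?_).trans_eq (by simp)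
    rw [← condH_comp_measurePreserving μ (hT.iterate t) hβ hγ]
    exact condH_le_of_factor μ (hB t) hCm (hC t) fun x y h => congrFun h t
  unfold condH at h2 ⊢
  linarith

lemma entropyPart_mul_le {T : Ω → Ω} (hT : MeasurePreserving T μ μ) {k : ℕ} {β : Ω → Fin k}
    {γ : Ω → J} (hβ : Measurable β) (hγ : Measurable γ) (n : ℕ) :
    entropyPart μ T β * (n + 1)
      ≤ partEnt μ (fun x (t : Fin (n + 1)) => γ (T^[t] x)) + (n + 1) * condH μ β γ := by
  have h1 : entropyPart μ T β
      ≤ partEnt μ (fun x (t : Fin (n + 1)) => β (T^[t] x)) / ((n : ℝ) + 1) :=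
    ciInf_le ⟨0, by
      rintro _ ⟨m, rfl⟩
      exact div_nonneg (partEnt_nonneg μ _) (by positivity)⟩ n
  rw [le_div_iff₀ (by positivity)] at h1
  have h2 := partEnt_iterate_le μ hT hβ hγ (n + 1)
  push_cast at h2
  exact h1.trans h2

end Partitions

section MetricEntropy

variable {A : Type*} [Fintype A] [TopologicalSpace A] [DiscreteTopology A] [MeasurableSpace A]
  [MeasurableSingletonClass A]

set_option linter.unusedSectionVars false

lemma exists_condH_win_lt (μ : Measure (ℤ → A)) [IsProbabilityMeasure μ] {I : Type*} [Fintype I]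
    [MeasurableSpace I] [MeasurableSingletonClass I] {β : (ℤ → A) → I} (hβ : Measurable β) {ε : ℝ}
    (hε : 0 < ε) (r : ℕ) :
    ∃ q : ℕ, r ≤ q ∧ condH μ β (win (-(q : ℤ)) (2 * q + 1)) < ε := by
  let ℱ : Filtration ℕ (MeasurableSpace.pi : MeasurableSpace (ℤ → A)) :=
    { seq := fun q => MeasurableSpace.comap (win (-(q : ℤ)) (2 * q + 1)) inferInstance
      mono' := fun p q hpq => comap_win_mono (by omega) (by push_cast; omega)
      le' := fun q => Measurable.comap_le (measurable_win _ _) }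
  have htop : ⨆ q, ℱ q = (MeasurableSpace.pi : MeasurableSpace (ℤ → A)) := by
    refine le_antisymm (iSup_le ℱ.le) (iSup_le fun i => ?_)
    refine le_trans ?_ (le_iSup (fun q => ℱ q) i.natAbs)
    change MeasurableSpace.comap (fun x : ℤ → A => x i) _ ≤ MeasurableSpace.comap
      (win (-(i.natAbs : ℤ)) (2 * i.natAbs + 1)) inferInstance
    have h : (fun x : ℤ → A => x i)
        = (fun u : Fin (2 * i.natAbs + 1) → A => u ⟨(i + i.natAbs).toNat, by omega⟩)
          ∘ win (-(i.natAbs : ℤ)) (2 * i.natAbs + 1) := by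
      funext x
      simp only [Function.comp_apply, win]
      congr 1
      omega
    rw [h, ← MeasurableSpace.comap_comp]
    exact MeasurableSpace.comap_mono (measurable_pi_apply _).comap_le
  have h := tendsto_condH_zero μ hβ (fun q => measurable_win (-(q : ℤ)) (2 * q + 1)) ℱ
    (fun _ => rfl) htop
  obtain ⟨q, h1, h2⟩ := ((h.eventually_lt_const hε).and (eventually_ge_atTop r)).exists
  exact ⟨q, h2, h1⟩

variable {μ : Measure (ℤ → A)} [IsProbabilityMeasure μ]

lemma entropyPart_shiftMap_le (hσ : MeasurePreserving (shiftMap A) μ μ) {k : ℕ}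
    {β : (ℤ → A) → Fin k} (hβ : Measurable β) : entropyPart μ (shiftMap A) β ≤ entRate μ := by
  refine le_of_forall_pos_le_add fun ε hε => ?_
  obtain ⟨q, -, hq⟩ := exists_condH_win_lt μ hβ (half_pos hε) 0
  obtain ⟨K, hK⟩ := exists_partEnt_win_le hσ (half_pos hε)
  refine le_of_eventually_mul_le (C := (2 * q + 1) * (entRate μ + ε / 2) + K + ε / 2
    - entropyPart μ (shiftMap A) β) (Eventually.of_forall fun n => ?_)
  have h1 := entropyPart_mul_le μ hσ hβ (measurable_win (-(q : ℤ)) (2 * q + 1)) n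
  have h2 : partEnt μ (fun x (t : Fin (n + 1)) => win (-(q : ℤ)) (2 * q + 1) ((shiftMap A)^[t] x))
      ≤ partEnt μ (win (A := A) 0 (2 * q + 1 + n)) := by
    rw [← partEnt_win μ hσ (-(q : ℤ))]
    refine partEnt_le_of_factor μ (measurable_win _ _) fun x y h => funext fun t => ?_
    rw [win_eq_iff] at h
    rw [← shiftIter_one, iterate_shiftIter, iterate_shiftIter, win_shiftIter, win_shiftIter,
      win_eq_iff]
    exact fun k h1 h2 => h k (by omega) (by have := t.2; push_cast at h2 ⊢; omega)
  have h3 := hK (2 * q + 1 + n)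
  push_cast at h3
  have h4 : ((n : ℝ) + 1) * condH μ β (win (-(q : ℤ)) (2 * q + 1)) ≤ (n + 1) * (ε / 2) :=
    mul_le_mul_of_nonneg_left hq.le (by positivity)
  nlinarith

lemma entRate_le_metricEntropy (hσ : MeasurePreserving (shiftMap A) μ μ) :
    entRate μ ≤ metricEntropy μ (shiftMap A) := by
  classical
  let e := Fintype.equivFin A
  have he : Measurable e := measurable_of_countable _
  have hβ : Measurable fun x : ℤ → A => e (x 0) := he.comp (measurable_pi_apply 0)
  refine le_trans ?_ (le_ciSup (f := fun p : {q : Σ k : ℕ, (ℤ → A) → Fin k // Measurable q.2} =>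
    entropyPart μ (shiftMap A) p.1.2) ⟨entRate μ, ?_⟩ ⟨⟨Fintype.card A, fun x => e (x 0)⟩, hβ⟩)
  · refine le_ciInf fun n => ?_
    rw [le_div_iff₀ (by positivity), mul_comm]
    have h := mul_entRate_le μ hσ (n + 1)
    push_cast at h
    refine h.trans_eq (partEnt_eq_of_factor μ (measurable_win _ _) (measurable_pi_lambda _ fun t =>
      hβ.comp (hσ.measurable.iterate t)) fun x y => ?_)
    rw [win_eq_iff, funext_iff]
    simp only [← shiftIter_one, iterate_shiftIter, e.injective.eq_iff, shiftIter]
    refine ⟨fun h k h1 h2 => ?_, fun h t => h _ (by omega) (by have := t.2; omega)⟩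
    have := h ⟨k.toNat, by omega⟩
    simpa [h1] using this
  · rintro _ ⟨p, rfl⟩
    exact entropyPart_shiftMap_le hσ p.2

end MetricEntropy

namespace IsErgodicCA

variable {A : Type*} [Fintype A] [TopologicalSpace A] [DiscreteTopology A] [MeasurableSpace A]
  [MeasurableSingletonClass A] {X : Set (ℤ → A)} {F : (ℤ → A) → ℤ → A} {r : ℕ}
  {μ : Measure (ℤ → A)} [IsProbabilityMeasure μ]

set_option linter.unusedSectionVars false

/-- The entropy of the space-time blocks of a fixed width grows at most linearly in the height,
with slope `entRate μ * (avgIplus X F μ + avgIminus X F μ)`. -/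
lemma eventually_partEnt_col_le (h : IsErgodicCA X F r μ) {w : ℕ} (hw : r ≤ w) {ε : ℝ}
    (hε : 0 < ε) :
    ∀ᶠ n : ℕ in atTop, partEnt μ (col F 0 w n)
      ≤ (entRate μ * (avgIplus X F μ + avgIminus X F μ) + ε) * n := by
  have hσ := h.ergodic.toMeasurePreserving
  have hδ : 0 < ε / (8 * (r + 1)) := by positivity
  set δ := ε / (8 * (r + 1))
  obtain ⟨K, hK⟩ := exists_partEnt_win_le hσ hδ
  obtain ⟨n₀, hn₀⟩ := exists_nat_gt ((w * entRate μ + 2 * δ * w + 2 * K) / (ε / 4))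
  rw [div_lt_iff₀ (by positivity)] at hn₀
  filter_upwards [h.eventually_condH_col_le hw (show 0 < ε / 4 by positivity),
    h.eventually_condH_col_left_le hw (show 0 < ε / 4 by positivity), eventually_ge_atTop n₀]
    with n h1 h2 hn
  have hU := measurable_win (A := A) 0 (w + r * n)
  have hV := measurable_win (A := A) (-((r * n : ℕ) : ℤ)) (w + r * n)
  have h3 := partEnt_le_add_condH μ (measurable_col h.measurePreserving.measurable 0 w n) hU hV
    fun x y hx hy => by
      rw [win_eq_iff] at hx hy
      rw [col_eq_iff]
      intro t ht k hk0 hkw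
      have hrt : ((r * t : ℕ) : ℤ) ≤ ((r * n : ℕ) : ℤ) := by
        exact_mod_cast Nat.mul_le_mul_left r ht
      refine h.dependsWithin.iterate t x y k fun j hj1 hj2 => ?_
      rcases le_or_gt 0 j with hj | hj
      · exact hx j hj (by push_cast at *; linarith)
      · exact hy j (by linarith) (by push_cast; linarith)
  have h4 : partEnt μ (fun x : ℤ → A => (win 0 (w + r * n) x,
      win (-((r * n : ℕ) : ℤ)) (w + r * n) x)) = partEnt μ (win (A := A) 0 (w + 2 * (r * n))) := by
    rw [← partEnt_win μ hσ (-((r * n : ℕ) : ℤ)) (w + 2 * (r * n))]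
    refine partEnt_eq_of_factor μ (hU.prodMk hV) (measurable_win _ _) fun x y => ?_
    rw [Prod.mk.injEq, win_eq_iff, win_eq_iff, win_eq_iff]
    push_cast
    refine ⟨fun hxy => ⟨fun k _ _ => hxy k ?_ ?_, fun k _ _ => hxy k ?_ ?_⟩,
      fun hxy k _ _ => ?_⟩
    · nlinarith
    · nlinarith
    · nlinarith
    · nlinarith
    · rcases le_or_gt 0 k with hk | hk
      · exact hxy.1 k hk (by linarith)
      · exact hxy.2 k (by linarith) (by linarith)
  rw [h4, partEnt_win μ hσ (-((r * n : ℕ) : ℤ))] at h3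
  have h5 := hK (w + r * n)
  have h6 := mul_entRate_le μ hσ (w + 2 * (r * n))
  have hn' : (n₀ : ℝ) * (ε / 4) ≤ n * (ε / 4) := by gcongr
  have h7 : 2 * (δ * (r * n)) ≤ ε / 4 * n := by
    have : δ * (8 * (r + 1)) = ε := div_mul_cancel₀ _ (by positivity)
    have h0 : 0 ≤ δ * n := by positivity
    rw [← this]
    nlinarith
  push_cast at h5 h6
  linarith

lemma entropyPart_le (h : IsErgodicCA X F r μ) {k : ℕ} {β : (ℤ → A) → Fin k} (hβ : Measurable β) :
    entropyPart μ F β ≤ entRate μ * (avgIplus X F μ + avgIminus X F μ) := by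
  refine le_of_forall_pos_le_add fun ε hε => ?_
  obtain ⟨q, hqr, hq⟩ := exists_condH_win_lt μ hβ (half_pos hε) r
  refine le_of_eventually_mul_le (C := ε / 2 - entropyPart μ F β) ?_
  filter_upwards [h.eventually_partEnt_col_le (show r ≤ 2 * q + 1 by omega) (half_pos hε)]
    with n hn
  have h1 := entropyPart_mul_le μ h.measurePreserving hβ (measurable_win (-(q : ℤ)) (2 * q + 1)) n
  have h2 : partEnt μ (fun x (t : Fin (n + 1)) => win (-(q : ℤ)) (2 * q + 1) (F^[t] x))
      = partEnt μ (col F 0 (2 * q + 1) n) := by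
    rw [← partEnt_comp_measurePreserving μ
      (measurePreserving_shiftIter h.ergodic.toMeasurePreserving (-(q : ℤ)))
      (measurable_col h.measurePreserving.measurable 0 (2 * q + 1) n)]
    simp only [col_shiftIter h.comm, zero_add]
    rfl
  have h4 : ((n : ℝ) + 1) * condH μ β (win (-(q : ℤ)) (2 * q + 1)) ≤ (n + 1) * (ε / 2) :=
    mul_le_mul_of_nonneg_left hq.le (by positivity)
  nlinarith

lemma metricEntropy_le (h : IsErgodicCA X F r μ) :
    metricEntropy μ F
      ≤ metricEntropy μ (shiftMap A) * (avgIplus X F μ + avgIminus X F μ) := by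
  have h0 : 0 ≤ avgIplus X F μ + avgIminus X F μ :=
    add_nonneg h.avgIplus_nonneg h.avgIminus_nonneg
  have h1 : metricEntropy μ F ≤ entRate μ * (avgIplus X F μ + avgIminus X F μ) :=
    Real.iSup_le (fun p => h.entropyPart_le p.2) (mul_nonneg (entRate_nonneg μ) h0)
  exact h1.trans (mul_le_mul_of_nonneg_right
    (entRate_le_metricEntropy h.ergodic.toMeasurePreserving) h0)

end IsErgodicCA

lemma ae_mem_msupp {A : Type*} [Fintype A] [TopologicalSpace A] [DiscreteTopology A]
    [MeasurableSpace A] (μ : Measure (ℤ → A)) : ∀ᵐ x ∂μ, x ∈ msupp μ := by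
  refine measure_null_of_locally_null _ fun x hx => ?_
  have : ∃ U, IsOpen U ∧ x ∈ U ∧ μ U = 0 := by
    by_contra! hU
    exact hx fun U h1 h2 => pos_iff_ne_zero.2 (hU U h1 h2)
  obtain ⟨U, h1, h2, h3⟩ := this
  exact ⟨U, mem_nhdsWithin_of_mem_nhds (h1.mem_nhds h2), h3⟩

/-- If `F` has no equicontinuous point in `S(μ)`, then
`h_μ(F) ≤ h_μ(σ) · (I_μ⁺ + I_μ⁻)`. -/
theorem stmt9 {A : Type*} [Fintype A] [TopologicalSpace A] [DiscreteTopology A]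
    [MeasurableSpace A] [BorelSpace A]
    (X : Set (ℤ → A)) (hXcl : IsClosed X) (hXσ : shiftMap A '' X = X)
    (F : (ℤ → A) → (ℤ → A)) (hFX : Set.MapsTo F X X) (hFc : Continuous F)
    (hFσ : ∀ x, F (shiftMap A x) = shiftMap A (F x))
    (r : ℕ) (hr : 1 ≤ r) (hloc : HasLocalRule F r)
    (μ : Measure (ℤ → A)) [IsProbabilityMeasure μ]
    (herg : Ergodic (shiftMap A) μ) (hFinv : MeasurePreserving F μ μ)
    (hsuppX : msupp μ ⊆ X)
    (hec : ¬ ∃ x ∈ msupp μ, IsEquicontPt X F x) :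
    metricEntropy μ F ≤ metricEntropy μ (shiftMap A) * (avgIplus X F μ + avgIminus X F μ) := by
  have h : IsErgodicCA X F r μ :=
    { isClosed := hXcl
      image_shift := hXσ
      mapsTo := hFX
      continuous := hFc
      comm := hFσ
      dependsWithin := hloc.dependsWithin
      ergodic := herg
      measurePreserving := hFinv
      ae_mem := (ae_mem_msupp μ).mono fun _ hx => hsuppX hx }
  exact h.metricEntropy_le
end
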